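/- arXiv:1611.02384 — 2 statements merged into one kernel-verified Lean document; each statement's English description precedes it below -/
import Mathlib

section
/- Let m = 2n ≥ 4 and let U ⊆ ℝ^{2n} be a domain. Let F⃗ := (−x², x¹, −x⁴, x³, ..., −x^{2n}, x^{2n−1}) and let u, v be C² functions on U with ∇u + F⃗ ≠ 0 and ∇v + F⃗ ≠ 0 everywhere on U. Suppose H_F(u) ≤ H_F(v) in U, u ≥ v in U, and u = v at some point p₀ ∈ U. Then u ≡ v in U. -/
open Set Finset

noncomputable section

/-- The `k`-th standard basis vector of `ℝ^N` (zero if `k ≥ N`). -/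
def ee (N k : ℕ) : Fin N → ℝ := fun i => if (i : ℕ) = k then 1 else 0

/-- The `k`-th coordinate of a point of `ℝ^N` (zero if `k ≥ N`). -/
def cv (N k : ℕ) (x : Fin N → ℝ) : ℝ := if h : k < N then x ⟨k, h⟩ else 0

/-- The `k`-th partial derivative. -/
def pd (N k : ℕ) (f : (Fin N → ℝ) → ℝ) (x : Fin N → ℝ) : ℝ := fderiv ℝ f x (ee N k)

/-- `∇u + F`. -/
def gradF (N : ℕ) (F : (Fin N → ℝ) → (Fin N → ℝ)) (u : (Fin N → ℝ) → ℝ)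
    (x : Fin N → ℝ) : Fin N → ℝ :=
  fun i => pd N i u x + F x i

/-- The Legendrian (horizontal) normal `N_F(u) = (∇u + F)/|∇u + F|`. -/
def legN (N : ℕ) (F : (Fin N → ℝ) → (Fin N → ℝ)) (u : (Fin N → ℝ) → ℝ)
    (x : Fin N → ℝ) : Fin N → ℝ :=
  fun i => gradF N F u x i / Real.sqrt (∑ k, (gradF N F u x k) ^ 2)

/-- The horizontal (p-)mean curvature `H_F(u) = div N_F(u)`. -/
def Hmc (N : ℕ) (F : (Fin N → ℝ) → (Fin N → ℝ)) (u : (Fin N → ℝ) → ℝ)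
    (x : Fin N → ℝ) : ℝ :=
  ∑ i : Fin N, pd N (i : ℕ) (fun y => legN N F u y i) x

/-- The Heisenberg vector field `F = (−x², x¹, −x⁴, x³, ..., −x^{2n}, x^{2n−1})`
on `ℝ^{2n}` (`0`-based indices). -/
def heisF (n : ℕ) : (Fin (2 * n) → ℝ) → (Fin (2 * n) → ℝ) :=
  fun x j => if (j : ℕ) % 2 = 0 then -(cv (2 * n) ((j : ℕ) + 1) x)
             else cv (2 * n) ((j : ℕ) - 1) x

/-- The Hessian of `f` at `x`, as a bilinear form. -/
def hess {N : ℕ} (f : (Fin N → ℝ) → ℝ) (x : Fin N → ℝ) :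
    (Fin N → ℝ) →L[ℝ] (Fin N → ℝ) →L[ℝ] ℝ :=
  fderiv ℝ (fderiv ℝ f) x

/-- The infinitesimal rotation in the `k`-`l` plane, applied to `P`. -/
def rotVec {N : ℕ} (P : Fin N → ℝ) (k l : Fin N) : Fin N → ℝ :=
  P k • ee N l - P l • ee N k

/-- The degenerate elliptic operator `|P|⁻³ (|P|² tr B - B(P, P))`, as a sum of squares. -/
def mcOp {N : ℕ} (P : Fin N → ℝ) (B : (Fin N → ℝ) →L[ℝ] (Fin N → ℝ) →L[ℝ] ℝ) : ℝ :=
  (∑ k, ∑ l, B (rotVec P k l) (rotVec P k l)) / (2 * Real.sqrt (∑ k, P k ^ 2) ^ 3)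

theorem IsLocalMin.hasDerivAt_deriv_nonneg {f f' : ℝ → ℝ} {a c : ℝ} (hmin : IsLocalMin f a)
    (hf : ∀ᶠ t in nhds a, HasDerivAt f (f' t) t) (hf' : HasDerivAt f' c a) : 0 ≤ c := by
  by_contra! hc
  have hd : deriv f =ᶠ[nhds a] f' := hf.mono fun t ht => ht.deriv
  have hd2 : deriv (deriv f) a = c := by rw [hd.deriv_eq, hf'.deriv]
  have hmax : IsLocalMax f a := by
    apply isLocalMax_of_deriv_deriv_neg
    · rw [hd2]; exact hc
    · rw [hmin.deriv_eq_zero]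
    · exact hf.self_of_nhds.continuousAt
  have hconst : f =ᶠ[nhds a] fun _ => f a := by
    filter_upwards [hmin, hmax] with t h1 h2
    exact le_antisymm h2 h1
  have h1 : deriv f =ᶠ[nhds a] fun _ => 0 := by
    filter_upwards [hconst.eventuallyEq_nhds] with t ht
    rw [ht.deriv_eq, deriv_const]
  rw [h1.deriv_eq, deriv_const] at hd2
  exact hc.ne hd2.symm

theorem ContDiffAt.hasFDerivAt_fderiv {N : ℕ} {f : (Fin N → ℝ) → ℝ} {x : Fin N → ℝ}
    (hf : ContDiffAt ℝ 2 f x) : HasFDerivAt (fderiv ℝ f) (hess f x) x :=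
  ((hf.fderiv_right (m := 1) (by norm_num)).differentiableAt (by norm_num)).hasFDerivAt

theorem IsLocalMin.hess_nonneg {N : ℕ} {f : (Fin N → ℝ) → ℝ} {x : Fin N → ℝ}
    (hmin : IsLocalMin f x) (hf : ContDiffAt ℝ 2 f x) (a : Fin N → ℝ) : 0 ≤ hess f x a a := by
  have hline : ∀ t : ℝ, HasDerivAt (fun t : ℝ => x + t • a) a t := fun t => by
    simpa using ((hasDerivAt_id t).smul_const a).const_add x
  have hline0 : Filter.Tendsto (fun t : ℝ => x + t • a) (nhds 0) (nhds x) := by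
    simpa using (hline 0).continuousAt.tendsto
  refine IsLocalMin.hasDerivAt_deriv_nonneg (f := fun t : ℝ => f (x + t • a))
    (f' := fun t => fderiv ℝ f (x + t • a) a) (a := 0) ?_ ?_ ?_
  · have := hline0.eventually hmin
    simpa [IsLocalMin, IsMinFilter] using this
  · have hd : ∀ᶠ y in nhds x, DifferentiableAt ℝ f y :=
      (hf.eventually (by simp)).mono fun y hy => hy.differentiableAt (by norm_num)
    filter_upwards [hline0.eventually hd] with t ht
    exact ht.hasFDerivAt.comp_hasDerivAt t (hline t)
  · have h2 : HasFDerivAt (fderiv ℝ f) (hess f x) (x + (0 : ℝ) • a) := by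
      simpa using hf.hasFDerivAt_fderiv
    have h3 := h2.comp_hasDerivAt (0 : ℝ) (hline 0)
    simpa using h3.clm_apply (hasDerivAt_const (0 : ℝ) a)

theorem hess_sub {N : ℕ} {f g : (Fin N → ℝ) → ℝ} {x : Fin N → ℝ}
    (hf : ContDiffAt ℝ 2 f x) (hg : ContDiffAt ℝ 2 g x) :
    hess (fun y => f y - g y) x = hess f x - hess g x := by
  have h : fderiv ℝ (fun y => f y - g y) =ᶠ[nhds x] fun y => fderiv ℝ f y - fderiv ℝ g y := by
    filter_upwards [hf.eventually (by simp), hg.eventually (by simp)] with y h1 h2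
    exact fderiv_fun_sub (h1.differentiableAt (by norm_num)) (h2.differentiableAt (by norm_num))
  rw [hess, h.fderiv_eq]
  exact (hf.hasFDerivAt_fderiv.sub hg.hasFDerivAt_fderiv).fderiv

theorem fderiv_expBarrier {N : ℕ} {φ : (Fin N → ℝ) → ℝ} {y : Fin N → ℝ} (ε α : ℝ)
    (hφ : DifferentiableAt ℝ φ y) :
    fderiv ℝ (fun y => ε * (Real.exp (α * φ y) - 1)) y =
      (ε * (α * Real.exp (α * φ y))) • fderiv ℝ φ y := by
  have := (((hφ.hasFDerivAt.const_mul α).exp).sub_const 1).const_mul ε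
  rw [this.fderiv]
  ext a
  simp
  ring

theorem hess_expBarrier {N : ℕ} {φ : (Fin N → ℝ) → ℝ} {x : Fin N → ℝ} (ε α : ℝ)
    (hφ : ContDiffAt ℝ 2 φ x) (a : Fin N → ℝ) :
    hess (fun y => ε * (Real.exp (α * φ y) - 1)) x a a =
      ε * (α * Real.exp (α * φ x)) * (α * fderiv ℝ φ x a ^ 2 + hess φ x a a) := by
  have h : fderiv ℝ (fun y => ε * (Real.exp (α * φ y) - 1)) =ᶠ[nhds x]
      fun y => (ε * (α * Real.exp (α * φ y))) • fderiv ℝ φ y := by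
    filter_upwards [hφ.eventually (by simp)] with y h1
    exact fderiv_expBarrier ε α (h1.differentiableAt (by norm_num))
  have hd := (hφ.differentiableAt (by norm_num)).hasFDerivAt
  have h2 := (((hd.const_mul α).exp.const_mul α).const_mul ε).smul hφ.hasFDerivAt_fderiv
  rw [hess, h.fderiv_eq]
  erw [h2.fderiv]
  simp
  ring

theorem ee_eq_single {N : ℕ} (i : Fin N) : ee N i = Pi.single i 1 := by
  ext j
  simp [ee, Pi.single_apply, Fin.ext_iff]

theorem cv_coe {N : ℕ} (i : Fin N) (x : Fin N → ℝ) : cv N i x = x i := by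
  simp [cv]

theorem cv_add (N k : ℕ) (x y : Fin N → ℝ) : cv N k (x + y) = cv N k x + cv N k y := by
  unfold cv
  split_ifs <;> simp

theorem cv_smul (N k : ℕ) (c : ℝ) (x : Fin N → ℝ) : cv N k (c • x) = c * cv N k x := by
  unfold cv
  split_ifs <;> simp

/-- The Heisenberg vector field as a continuous linear map. -/
def heisL (n : ℕ) : (Fin (2 * n) → ℝ) →L[ℝ] (Fin (2 * n) → ℝ) :=
  LinearMap.toContinuousLinearMap
    { toFun := heisF n
      map_add' := fun x y => by
        ext j
        simp only [heisF, Pi.add_apply, cv_add]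
        split_ifs <;> ring
      map_smul' := fun c x => by
        ext j
        simp only [heisF, Pi.smul_apply, cv_smul, smul_eq_mul, RingHom.id_apply]
        split_ifs <;> ring }

theorem heisL_apply (n : ℕ) (x : Fin (2 * n) → ℝ) : heisL n x = heisF n x := rfl

theorem Finset.sum_range_two_mul (G : ℕ → ℝ) (n : ℕ) :
    ∑ i ∈ Finset.range (2 * n), G i = ∑ k ∈ Finset.range n, (G (2 * k) + G (2 * k + 1)) := by
  induction n with
  | zero => simp
  | succ n ih =>
    rw [mul_add, mul_one, Finset.sum_range_succ, Finset.sum_range_succ, ih,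
      Finset.sum_range_succ]
    ring

theorem heisF_dotProduct (n : ℕ) (a b : Fin (2 * n) → ℝ) :
    heisF n a ⬝ᵥ b = ∑ k ∈ Finset.range n, (cv (2 * n) (2 * k) a * cv (2 * n) (2 * k + 1) b -
      cv (2 * n) (2 * k + 1) a * cv (2 * n) (2 * k) b) := by
  have h : heisF n a ⬝ᵥ b = ∑ j : Fin (2 * n), (fun j : ℕ => (if j % 2 = 0 then
      -(cv (2 * n) (j + 1) a) else cv (2 * n) (j - 1) a) * cv (2 * n) j b) j := by
    simp [dotProduct, heisF, cv_coe]
  rw [h, Fin.sum_univ_eq_sum_range (fun j : ℕ => (if j % 2 = 0 then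
      -(cv (2 * n) (j + 1) a) else cv (2 * n) (j - 1) a) * cv (2 * n) j b),
    Finset.sum_range_two_mul]
  refine Finset.sum_congr rfl fun k _ => ?_
  have h1 : (2 * k + 1) % 2 = 1 := by omega
  simp [h1]
  ring

theorem heisF_dotProduct_skew (n : ℕ) (a b : Fin (2 * n) → ℝ) :
    heisF n a ⬝ᵥ b = -(heisF n b ⬝ᵥ a) := by
  rw [heisF_dotProduct, heisF_dotProduct, ← Finset.sum_neg_distrib]
  exact Finset.sum_congr rfl fun k _ => by ring

theorem heisF_heisF (n : ℕ) (a : Fin (2 * n) → ℝ) : heisF n (heisF n a) = -a := by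
  ext j
  have hj := j.2
  by_cases h : (j : ℕ) % 2 = 0
  · have h1 : (j : ℕ) + 1 < 2 * n := by omega
    have h2 : ((j : ℕ) + 1) % 2 = 1 := by omega
    simp [heisF, h, cv, h1, h2]
  · have h1 : (j : ℕ) - 1 < 2 * n := by omega
    have h2 : ((j : ℕ) - 1) % 2 = 0 := by omega
    have h3 : (j : ℕ) - 1 + 1 = j := by omega
    simp [heisF, h, cv, h1, h2, h3]

/-- The derivative of `gradF` at `x` applied to `a`. -/
def gradFDeriv (n : ℕ) (B : (Fin (2 * n) → ℝ) →L[ℝ] (Fin (2 * n) → ℝ) →L[ℝ] ℝ) :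
    (Fin (2 * n) → ℝ) →L[ℝ] (Fin (2 * n) → ℝ) :=
  ContinuousLinearMap.pi (fun i : Fin (2 * n) => B.flip (ee (2 * n) i)) + heisL n

theorem gradFDeriv_apply (n : ℕ) (B : (Fin (2 * n) → ℝ) →L[ℝ] (Fin (2 * n) → ℝ) →L[ℝ] ℝ)
    (a : Fin (2 * n) → ℝ) (i : Fin (2 * n)) :
    gradFDeriv n B a i = B a (ee (2 * n) i) + heisF n a i := by
  simp [gradFDeriv, heisL_apply]

theorem sum_smul_ee {N : ℕ} (b : Fin N → ℝ) : ∑ i, b i • ee N i = b := by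
  simp_rw [ee_eq_single]
  ext j
  simp [Finset.sum_apply, Pi.single_apply]

theorem gradFDeriv_dotProduct (n : ℕ)
    (B : (Fin (2 * n) → ℝ) →L[ℝ] (Fin (2 * n) → ℝ) →L[ℝ] ℝ) (a b : Fin (2 * n) → ℝ) :
    gradFDeriv n B a ⬝ᵥ b = B a b + heisF n a ⬝ᵥ b := by
  have h : B a b = ∑ i : Fin (2 * n), B a (ee (2 * n) i) * b i := by
    conv_lhs => rw [← sum_smul_ee b]
    simp [mul_comm]
  simp only [dotProduct, gradFDeriv_apply, add_mul, Finset.sum_add_distrib, h]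

theorem hasFDerivAt_gradF {n : ℕ} {u : (Fin (2 * n) → ℝ) → ℝ} {x : Fin (2 * n) → ℝ}
    (hu : ContDiffAt ℝ 2 u x) :
    HasFDerivAt (gradF (2 * n) (heisF n) u) (gradFDeriv n (hess u x)) x := by
  rw [hasFDerivAt_pi']
  intro i
  have h1 := hu.hasFDerivAt_fderiv.clm_apply (hasFDerivAt_const (ee (2 * n) i) x)
  have h2 : HasFDerivAt (fun y => heisL n y i)
      ((ContinuousLinearMap.proj i).comp (heisL n)) x :=
    ((ContinuousLinearMap.proj (R := ℝ) (φ := fun _ : Fin (2 * n) => ℝ) i).comp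
      (heisL n)).hasFDerivAt
  refine (h1.add h2).congr_fderiv ?_
  ext a
  simp [gradFDeriv_apply, heisL_apply]

theorem sum_sq_pos {N : ℕ} {P : Fin N → ℝ} (hP : P ≠ 0) : 0 < ∑ k, P k ^ 2 := by
  obtain ⟨k, hk⟩ := Function.ne_iff.mp hP
  exact Finset.sum_pos' (fun i _ => sq_nonneg _) ⟨k, Finset.mem_univ k, by
    have : P k ≠ 0 := hk
    positivity⟩

theorem sum_rotVec {N : ℕ} (P : Fin N → ℝ) (A : (Fin N → ℝ) →L[ℝ] (Fin N → ℝ)) :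
    ∑ k, ∑ l, A (rotVec P k l) ⬝ᵥ rotVec P k l =
      2 * ((∑ k, P k ^ 2) * ∑ i : Fin N, A (ee N i) i - ∑ k : Fin N, P k * ∑ l, P l * A (ee N k) l) := by
  have h : ∀ k l : Fin N, A (rotVec P k l) ⬝ᵥ rotVec P k l =
      P k ^ 2 * A (ee N l) l - P k * (P l * A (ee N k) l) - P l * (P k * A (ee N l) k)
        + P l ^ 2 * A (ee N k) k := by
    intro k l
    simp only [rotVec, map_sub, map_smul, dotProduct_sub, dotProduct_smul, sub_dotProduct,
      smul_dotProduct, smul_eq_mul]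
    simp only [ee_eq_single, dotProduct_single_one]
    ring
  simp only [h, Finset.sum_add_distrib, Finset.sum_sub_distrib]
  rw [Finset.sum_comm (f := fun k l : Fin N => P l * (P k * A (ee N l) k)),
    Finset.sum_comm (f := fun k l : Fin N => P l ^ 2 * A (ee N k) k)]
  have h2 : ∑ k, ∑ l : Fin N, P k ^ 2 * A (ee N l) l = (∑ k, P k ^ 2) * ∑ i : Fin N, A (ee N i) i := by
    rw [Finset.sum_mul_sum]
  have h3 : ∑ l, ∑ k : Fin N, P l ^ 2 * A (ee N k) k = (∑ k, P k ^ 2) * ∑ i : Fin N, A (ee N i) i := h2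
  simp only [← Finset.mul_sum] at h2 h3 ⊢
  rw [h2]
  ring

theorem Hmc_eq_mcOp {n : ℕ} {u : (Fin (2 * n) → ℝ) → ℝ} {x : Fin (2 * n) → ℝ}
    (hu : ContDiffAt ℝ 2 u x) (hx : gradF (2 * n) (heisF n) u x ≠ 0) :
    Hmc (2 * n) (heisF n) u x = mcOp (gradF (2 * n) (heisF n) u x) (hess u x) := by
  set P := gradF (2 * n) (heisF n) u with hP
  set A := gradFDeriv n (hess u x) with hA
  have hpos : 0 < ∑ k, P x k ^ 2 := sum_sq_pos hx
  have hs : 0 < Real.sqrt (∑ k, P x k ^ 2) := Real.sqrt_pos.2 hpos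
  have hs2 := Real.sq_sqrt hpos.le
  have hPd : HasFDerivAt P A x := hasFDerivAt_gradF hu
  have hPi : ∀ i, HasFDerivAt (fun y => P y i) ((ContinuousLinearMap.proj i).comp A) x :=
    hasFDerivAt_pi'.1 hPd
  have hsq := (HasFDerivAt.fun_sum (u := Finset.univ) fun k _ => (hPi k).pow 2).sqrt hpos.ne'
  have hterm : ∀ i : Fin (2 * n), pd (2 * n) i (fun y => legN (2 * n) (heisF n) u y i) x =
      A (ee (2 * n) i) i / Real.sqrt (∑ k, P x k ^ 2) - P x i *
        (∑ l, P x l * A (ee (2 * n) i) l) / Real.sqrt (∑ k, P x k ^ 2) ^ 3 := by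
    intro i
    have h1 := (hPi i).mul ((hasDerivAt_inv hs.ne').comp_hasFDerivAt x hsq)
    have h2 : (fun y => legN (2 * n) (heisF n) u y i) =
        (fun y => P y i) * ((fun r : ℝ => r⁻¹) ∘ fun y => Real.sqrt (∑ k, P y k ^ 2)) := by
      ext y
      simp [legN, hP, div_eq_mul_inv]
    rw [pd, h2, h1.fderiv]
    simp [← Finset.mul_sum, mul_assoc]
    field_simp
    ring
  have hquad : ∑ k, ∑ l, hess u x (rotVec (P x) k l) (rotVec (P x) k l) =
      ∑ k, ∑ l, A (rotVec (P x) k l) ⬝ᵥ rotVec (P x) k l := by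
    refine Finset.sum_congr rfl fun k _ => Finset.sum_congr rfl fun l _ => ?_
    have := heisF_dotProduct_skew n (rotVec (P x) k l) (rotVec (P x) k l)
    rw [hA, gradFDeriv_dotProduct]
    linarith
  rw [Hmc, mcOp, hquad, sum_rotVec]
  simp only [hterm, Finset.sum_sub_distrib, ← Finset.sum_div]
  rw [← hs2]
  simp only [Real.sqrt_sq hs.le]
  field_simp

theorem mcOp_sub {N : ℕ} (P : Fin N → ℝ) (B C : (Fin N → ℝ) →L[ℝ] (Fin N → ℝ) →L[ℝ] ℝ) :
    mcOp P (B - C) = mcOp P B - mcOp P C := by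
  simp [mcOp, Finset.sum_sub_distrib, sub_div]

theorem mcOp_mono {N : ℕ} (P : Fin N → ℝ) {B C : (Fin N → ℝ) →L[ℝ] (Fin N → ℝ) →L[ℝ] ℝ}
    (h : ∀ a, B a a ≤ C a a) : mcOp P B ≤ mcOp P C := by
  unfold mcOp
  gcongr
  exact h _

theorem contDiffAt_mcOp {N : ℕ} {P : Fin N → ℝ} (hP : P ≠ 0)
    (B : (Fin N → ℝ) →L[ℝ] (Fin N → ℝ) →L[ℝ] ℝ) :
    ContDiffAt ℝ 1 (fun q : (Fin N → ℝ) × ((Fin N → ℝ) →L[ℝ] (Fin N → ℝ) →L[ℝ] ℝ) =>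
      mcOp q.1 q.2) (P, B) := by
  have hpos := sum_sq_pos hP
  have hs : (2 * Real.sqrt (∑ k, P k ^ 2) ^ 3) ≠ 0 := by
    have := Real.sqrt_pos.2 hpos
    positivity
  have hcoord : ∀ k, ContDiffAt ℝ 1 (fun q : (Fin N → ℝ) ×
      ((Fin N → ℝ) →L[ℝ] (Fin N → ℝ) →L[ℝ] ℝ) => q.1 k) (P, B) := fun k => by fun_prop
  have hV : ∀ k l, ContDiffAt ℝ 1 (fun q : (Fin N → ℝ) ×
      ((Fin N → ℝ) →L[ℝ] (Fin N → ℝ) →L[ℝ] ℝ) => rotVec q.1 k l) (P, B) := fun k l =>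
    ((hcoord k).smul contDiffAt_const).sub ((hcoord l).smul contDiffAt_const)
  unfold mcOp
  refine ContDiffAt.div ?_ ?_ hs
  · exact ContDiffAt.sum fun k _ => ContDiffAt.sum fun l _ =>
      (contDiffAt_snd.clm_apply (hV k l)).clm_apply (hV k l)
  · have hsum : ContDiffAt ℝ 1 (fun q : (Fin N → ℝ) ×
        ((Fin N → ℝ) →L[ℝ] (Fin N → ℝ) →L[ℝ] ℝ) => ∑ k, q.1 k ^ 2) (P, B) :=
      ContDiffAt.sum fun k _ => (hcoord k).pow 2
    exact contDiffAt_const.mul ((hsum.sqrt hpos.ne').pow 3)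

theorem continuousAt_hess {N : ℕ} {f : (Fin N → ℝ) → ℝ} {x : Fin N → ℝ}
    (hf : ContDiffAt ℝ 2 f x) : ContinuousAt (hess f) x :=
  ((hf.fderiv_right (m := 1) (by norm_num)).fderiv_right (m := 0) (by norm_num)).continuousAt

theorem continuousAt_mcOp_hess {N : ℕ} {f : (Fin N → ℝ) → ℝ} {P : (Fin N → ℝ) → Fin N → ℝ}
    {x : Fin N → ℝ} (hP : ContinuousAt P x) (hPx : P x ≠ 0) (hf : ContDiffAt ℝ 2 f x) :
    ContinuousAt (fun y => mcOp (P y) (hess f y)) x :=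
  ContinuousAt.comp (f := fun y => (P y, hess f y))
    (contDiffAt_mcOp hPx (hess f x)).continuousAt (hP.prodMk (continuousAt_hess hf))

/-- The squared gradient form associated with `mcOp`. -/
def mcGrad {N : ℕ} (P : Fin N → ℝ) (L : (Fin N → ℝ) →L[ℝ] ℝ) : ℝ :=
  mcOp P (L.smulRight L)

theorem mcOp_add_smul {N : ℕ} (P : Fin N → ℝ) (r α : ℝ) (L : (Fin N → ℝ) →L[ℝ] ℝ)
    (B C : (Fin N → ℝ) →L[ℝ] (Fin N → ℝ) →L[ℝ] ℝ)
    (h : ∀ a, C a a = r * (α * L a ^ 2 + B a a)) :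
    mcOp P C = r * (α * mcGrad P L + mcOp P B) := by
  simp only [mcGrad, mcOp, h, ContinuousLinearMap.smulRight_apply,
    smul_apply, smul_eq_mul, ← Finset.mul_sum, Finset.sum_add_distrib,
    ← sq]
  ring

theorem continuousAt_mcGrad {N : ℕ} {P : (Fin N → ℝ) → Fin N → ℝ}
    {L : (Fin N → ℝ) → (Fin N → ℝ) →L[ℝ] ℝ} {x : Fin N → ℝ}
    (hP : ContinuousAt P x) (hPx : P x ≠ 0) (hL : ContinuousAt L x) :
    ContinuousAt (fun y => mcGrad (P y) (L y)) x := by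
  have h : ContinuousAt (fun y => (L y).smulRight (L y)) x := by
    have := (ContinuousLinearMap.smulRightL ℝ (Fin N → ℝ)
      ((Fin N → ℝ) →L[ℝ] ℝ)).continuous.continuousAt.comp hL
    exact this.clm_apply hL
  exact ContinuousAt.comp (f := fun y => (P y, (L y).smulRight (L y)))
    (contDiffAt_mcOp hPx ((L x).smulRight (L x))).continuousAt (hP.prodMk h)

theorem mcGrad_pos {N : ℕ} {P : Fin N → ℝ} (hP : P ≠ 0) {L : (Fin N → ℝ) →L[ℝ] ℝ}
    {k l : Fin N} (h : L (rotVec P k l) ≠ 0) : 0 < mcGrad P L := by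
  have hs : 0 < Real.sqrt (∑ k, P k ^ 2) := Real.sqrt_pos.2 (sum_sq_pos hP)
  unfold mcGrad mcOp
  refine div_pos ?_ (by positivity)
  simp only [ContinuousLinearMap.smulRight_apply, smul_apply, smul_eq_mul,
    ← sq]
  refine Finset.sum_pos' (fun i _ => Finset.sum_nonneg fun j _ => sq_nonneg _)
    ⟨k, Finset.mem_univ k, Finset.sum_pos' (fun j _ => sq_nonneg _)
      ⟨l, Finset.mem_univ l, by positivity⟩⟩

/-- At a point where the contact set `{u = v}` is touched from outside by a level set of `φ`, the
differential of `φ` vanishes on the directions orthogonal to `∇u + F`. -/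
theorem fderiv_rotVec_eq_zero_of_contact {N : ℕ} {u v φ : (Fin N → ℝ) → ℝ}
    {Pu Pv : (Fin N → ℝ) → Fin N → ℝ} {z : Fin N → ℝ}
    (hu : ContDiffAt ℝ 2 u z) (hv : ContDiffAt ℝ 2 v z) (hφ : ContDiffAt ℝ 2 φ z)
    (hPu : ContinuousAt Pu z) (hPv : ContinuousAt Pv z) (hPz : Pu z ≠ 0)
    (hdiff : ∀ᶠ y in nhds z, ∀ i : Fin N,
      Pu y i - Pv y i = fderiv ℝ u y (ee N i) - fderiv ℝ v y (ee N i))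
    (hineq : ∀ᶠ y in nhds z, mcOp (Pu y) (hess u y) ≤ mcOp (Pv y) (hess v y))
    (hle : ∀ᶠ y in nhds z, v y ≤ u y) (hz : u z = v z) (hφz : φ z = 0)
    (hneg : ∀ᶠ y in nhds z, u y = v y → y ≠ z → φ y < 0) (k l : Fin N) :
    fderiv ℝ φ z (rotVec (Pu z) k l) = 0 := by
  by_contra hkl
  have hPeq : Pu z = Pv z := by
    have hmin : IsLocalMin (fun y => u y - v y) z := by
      filter_upwards [hle] with y hy
      simpa [hz] using hy
    have h0 := hmin.fderiv_eq_zero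
    rw [fderiv_fun_sub (hu.differentiableAt (by norm_num))
      (hv.differentiableAt (by norm_num))] at h0
    ext i
    have h1 := hdiff.self_of_nhds i
    have h2 := congrArg (fun L => L (ee N i)) h0
    simp only [sub_apply, zero_apply] at h2
    linarith
  have hdφ : ContinuousAt (fderiv ℝ φ) z := hφ.hasFDerivAt_fderiv.continuousAt
  have hT0 := mcGrad_pos hPz hkl
  set c₀ := mcGrad (Pu z) (fderiv ℝ φ z) / 2 with hc₀
  have hc₀pos : 0 < c₀ := by positivity
  have hT : ∀ᶠ y in nhds z, c₀ < mcGrad (Pu y) (fderiv ℝ φ y) :=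
    (continuousAt_mcGrad hPu hPz hdφ).eventually (lt_mem_nhds (by rw [hc₀]; linarith))
  obtain ⟨s₀, hs₀⟩ := exists_lt (mcOp (Pu z) (hess φ z))
  have hS : ∀ᶠ y in nhds z, s₀ < mcOp (Pu y) (hess φ y) :=
    (continuousAt_mcOp_hess hPu hPz hφ).eventually (lt_mem_nhds hs₀)
  obtain ⟨d₀, hd₀⟩ := exists_gt ‖fun i : Fin N => fderiv ℝ φ z (ee N i)‖
  have hD : ∀ᶠ y in nhds z, ‖fun i : Fin N => fderiv ℝ φ y (ee N i)‖ < d₀ := by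
    have hcont : ContinuousAt (fun y => ‖fun i : Fin N => fderiv ℝ φ y (ee N i)‖) z :=
      (continuousAt_pi.2 fun i => hdφ.clm_apply continuousAt_const).norm
    exact hcont.eventually (gt_mem_nhds hd₀)
  obtain ⟨K, t, ht, hLip⟩ :=
    (contDiffAt_mcOp (hPeq ▸ hPz : Pv z ≠ 0) (hess v z)).exists_lipschitzOnWith
  have htu : ∀ᶠ y in nhds z, (Pu y, hess v y) ∈ t :=
    (hPu.prodMk (continuousAt_hess hv)).eventually (by simp only [hPeq]; exact ht)
  have htv : ∀ᶠ y in nhds z, (Pv y, hess v y) ∈ t :=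
    (hPv.prodMk (continuousAt_hess hv)).eventually ht
  obtain ⟨ρ, hρ, hball⟩ := Metric.nhds_basis_closedBall.eventually_iff.1
    ((((hu.eventually (by simp)).and (hv.eventually (by simp))).and (hφ.eventually (by simp))).and
      ((hdiff.and hineq).and ((hle.and hneg).and ((hT.and hS).and (hD.and (htu.and htv))))))
  have hud : ∀ y ∈ Metric.closedBall z ρ, ContDiffAt ℝ 2 u y := fun y hy => (hball hy).1.1.1
  have hvd : ∀ y ∈ Metric.closedBall z ρ, ContDiffAt ℝ 2 v y := fun y hy => (hball hy).1.1.2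
  have hφd : ∀ y ∈ Metric.closedBall z ρ, ContDiffAt ℝ 2 φ y := fun y hy => (hball hy).1.2
  obtain ⟨α, hα, hα2⟩ : ∃ α : ℝ, 0 < α ∧ K * d₀ < α * c₀ + s₀ := by
    refine ⟨(|K * d₀ - s₀| + 1) / c₀, by positivity, ?_⟩
    rw [div_mul_cancel₀ _ hc₀pos.ne']
    linarith [le_abs_self (K * d₀ - s₀)]
  have hwc : ContinuousOn (fun y => u y - v y) (Metric.closedBall z ρ) := fun y hy =>
    ((hud y hy).continuousAt.sub (hvd y hy).continuousAt).continuousWithinAt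
  have hφc : ContinuousOn φ (Metric.closedBall z ρ) := fun y hy =>
    (hφd y hy).continuousAt.continuousWithinAt
  have hsub : Metric.sphere z ρ ⊆ Metric.closedBall z ρ := Metric.sphere_subset_closedBall
  obtain ⟨c, hc, hcw⟩ : ∃ c > 0, ∀ y ∈ Metric.sphere z ρ, 0 ≤ φ y → c ≤ u y - v y := by
    have hcpt : IsCompact (Metric.sphere z ρ ∩ φ ⁻¹' Set.Ici 0) :=
      (isCompact_sphere z ρ).of_isClosed_subset
        ((hφc.mono hsub).preimage_isClosed_of_isClosed Metric.isClosed_sphere isClosed_Ici)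
        Set.inter_subset_left
    rcases (Metric.sphere z ρ ∩ φ ⁻¹' Set.Ici 0).eq_empty_or_nonempty with he | hne
    · exact ⟨1, one_pos, fun y hy hφy => (he.le ⟨hy, hφy⟩).elim⟩
    · obtain ⟨y₀, hy₀, hmin⟩ := hcpt.exists_isMinOn hne
        (hwc.mono (Set.inter_subset_left.trans hsub))
      refine ⟨u y₀ - v y₀, ?_, fun y hy hφy => hmin ⟨hy, hφy⟩⟩
      have hb := hball (hsub hy₀.1)
      refine lt_of_le_of_ne (sub_nonneg.2 hb.2.2.1.1) fun h0 => ?_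
      have hne : y₀ ≠ z := Metric.ne_of_mem_sphere hy₀.1 hρ.ne'
      exact absurd (hb.2.2.1.2 (sub_eq_zero.1 h0.symm) hne) (not_lt.2 hy₀.2)
  obtain ⟨M, hM⟩ := (isCompact_sphere z ρ).exists_bound_of_continuousOn
    (f := fun y => Real.exp (α * φ y) - 1)
    (((continuousOn_const.mul (hφc.mono hsub)).rexp).sub continuousOn_const)
  obtain ⟨ε, hε, hεM⟩ : ∃ ε : ℝ, 0 < ε ∧ ε * |M| < c := by
    refine ⟨c / (|M| + 1), by positivity, ?_⟩
    rw [div_mul_eq_mul_div, div_lt_iff₀ (by positivity)]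
    nlinarith
  set h : (Fin N → ℝ) → ℝ := fun y => ε * (Real.exp (α * φ y) - 1) with hh
  have hhd : ∀ y ∈ Metric.closedBall z ρ, ContDiffAt ℝ 2 h y := fun y hy =>
    contDiffAt_const.mul (((contDiffAt_const.mul (hφd y hy)).exp).sub contDiffAt_const)
  have hwd : ∀ y ∈ Metric.closedBall z ρ, ContDiffAt ℝ 2 (fun y => u y - v y) y := fun y hy =>
    (hud y hy).sub (hvd y hy)
  have hgd : ∀ y ∈ Metric.closedBall z ρ, ContDiffAt ℝ 2 (fun y => (u y - v y) - h y) y :=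
    fun y hy => (hwd y hy).sub (hhd y hy)
  obtain ⟨x, hx, hxmin⟩ := (isCompact_closedBall z ρ).exists_isMinOn
    (Metric.nonempty_closedBall.2 hρ.le)
    (fun y hy => (hgd y hy).continuousAt.continuousWithinAt :
      ContinuousOn (fun y => (u y - v y) - h y) (Metric.closedBall z ρ))
  have hbx := hball hx
  have hxball : x ∈ Metric.ball z ρ := by
    refine lt_of_le_of_ne (Metric.mem_closedBall.1 hx) fun hxs => ?_
    have h1 : (u x - v x) - h x ≤ (u z - v z) - h z := hxmin (Metric.mem_closedBall_self hρ.le)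
    have h2 : (u z - v z) - h z = 0 := by simp [hh, hz, hφz]
    rcases lt_or_ge (φ x) 0 with hneg' | hpos'
    · have h3 : Real.exp (α * φ x) < 1 := by
        rw [Real.exp_lt_one_iff]
        exact mul_neg_of_pos_of_neg hα hneg'
      have h4 : h x < 0 := mul_neg_of_pos_of_neg hε (by linarith)
      have h5 : v x ≤ u x := hbx.2.2.1.1
      linarith
    · have h3 := hcw x hxs hpos'
      have h4 : h x ≤ ε * |M| := mul_le_mul_of_nonneg_left
        ((le_abs_self _).trans ((hM x hxs).trans (le_abs_self M))) hε.le
      linarith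
  have hlocmin : IsLocalMin (fun y => (u y - v y) - h y) x :=
    hxmin.isLocalMin (Metric.closedBall_mem_nhds_of_mem hxball)
  set r := ε * (α * Real.exp (α * φ x)) with hr
  have hrpos : 0 < r := by positivity
  have hgrad : fderiv ℝ u x - fderiv ℝ v x = r • fderiv ℝ φ x := by
    have h0 := hlocmin.fderiv_eq_zero
    rw [fderiv_fun_sub ((hwd x hx).differentiableAt (by norm_num))
      ((hhd x hx).differentiableAt (by norm_num)),
      fderiv_fun_sub ((hud x hx).differentiableAt (by norm_num))
      ((hvd x hx).differentiableAt (by norm_num)),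
      fderiv_expBarrier ε α ((hφd x hx).differentiableAt (by norm_num))] at h0
    exact sub_eq_zero.1 h0
  have hnorm : ‖Pu x - Pv x‖ ≤ r * d₀ := by
    have h1 : Pu x - Pv x = r • fun i : Fin N => fderiv ℝ φ x (ee N i) := by
      ext i
      have := congrArg (fun L => L (ee N i)) hgrad
      simpa [hbx.2.1.1 i] using this
    rw [h1, norm_smul, Real.norm_of_nonneg hrpos.le]
    exact mul_le_mul_of_nonneg_left hbx.2.2.2.2.1.le hrpos.le
  have hlip : mcOp (Pv x) (hess v x) - mcOp (Pu x) (hess v x) ≤ K * (r * d₀) := by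
    have h1 := hLip.dist_le_mul _ hbx.2.2.2.2.2.2 _ hbx.2.2.2.2.2.1
    rw [Real.dist_eq, Prod.dist_eq, dist_self, dist_comm, dist_eq_norm,
      max_eq_left (norm_nonneg _)] at h1
    exact (le_abs_self _).trans (h1.trans (mul_le_mul_of_nonneg_left hnorm K.2))
  have hhess : mcOp (Pu x) (hess h x) ≤ mcOp (Pu x) (hess u x - hess v x) := by
    refine mcOp_mono _ fun a => ?_
    have h1 := hlocmin.hess_nonneg (hgd x hx) a
    rw [hess_sub (hwd x hx) (hhd x hx), hess_sub (hud x hx) (hvd x hx)] at h1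
    simpa using h1
  rw [mcOp_add_smul (Pu x) r α (fderiv ℝ φ x) (hess φ x) (hess h x)
    (hess_expBarrier ε α (hφd x hx)), mcOp_sub] at hhess
  have hop : mcOp (Pu x) (hess u x) ≤ mcOp (Pv x) (hess v x) := hbx.2.1.2
  have hTx : c₀ < mcGrad (Pu x) (fderiv ℝ φ x) := hbx.2.2.2.1.1
  have hSx : s₀ < mcOp (Pu x) (hess φ x) := hbx.2.2.2.1.2
  have hfin : r * (α * mcGrad (Pu x) (fderiv ℝ φ x) + mcOp (Pu x) (hess φ x)) ≤
      r * (K * d₀) := by linarith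
  have := le_of_mul_le_mul_left hfin hrpos
  nlinarith

section NearestPoint

open scoped InnerProductSpace

variable {E : Type*} [NormedAddCommGroup E] [InnerProductSpace ℝ E]

theorem tendsto_nearest_displacement {p : E → E} {A : E →L[ℝ] E} {x η : E} {r C : ℝ}
    {ζ : ℝ → E} (hp : HasFDerivAt p A x) (hpx : p x ≠ 0) (hA : |r| * ‖A‖ ≤ 1 / 2)
    (hη : ⟪p x, η⟫_ℝ = 0) (hζ : ∀ t, ‖ζ t‖ ≤ C * |t|) (hζp : ∀ t, |⟪p x, ζ t⟫_ℝ| ≤ C * t ^ 2)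
    (hcontact : ∀ᶠ t in nhdsWithin (0 : ℝ) (Set.Ioi 0),
      ∃ μ : ℝ, r • p x + t • (η + r • A η) - ζ t = μ • p (x + ζ t)) :
    Filter.Tendsto (fun t => t⁻¹ • ζ t) (nhdsWithin (0 : ℝ) (Set.Ioi 0)) (nhds η) := by
  set l := nhdsWithin (0 : ℝ) (Set.Ioi 0) with hl
  have ht0 : Filter.Tendsto (fun t : ℝ => t) l (nhds 0) := Filter.tendsto_id'.2 nhdsWithin_le_nhds
  have htpos : ∀ᶠ t in l, (0 : ℝ) < t := self_mem_nhdsWithin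
  have hζO : ζ =O[l] fun t => t := Asymptotics.IsBigO.of_bound C (.of_forall fun t => by
    simpa using hζ t)
  have hζ0 : Filter.Tendsto ζ l (nhds 0) := hζO.trans_tendsto ht0
  have hxζ : Filter.Tendsto (fun t => x + ζ t) l (nhds x) := by
    simpa using hζ0.const_add x
  have hpζ : Filter.Tendsto (fun t => p (x + ζ t)) l (nhds (p x)) :=
    hp.continuousAt.tendsto.comp hxζ
  have hR : (fun t => p (x + ζ t) - p x - A (ζ t)) =o[l] fun t => t := by
    have := (hp.isLittleO.comp_tendsto hxζ)
    simp only [Function.comp_def, add_sub_cancel_left] at this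
    exact this.trans_isBigO hζO
  have hR' : Filter.Tendsto (fun t => t⁻¹ • (p (x + ζ t) - p x - A (ζ t))) l (nhds 0) :=
    hR.tendsto_inv_smul_nhds_zero
  set P := p x with hP
  have hPP : ⟪P, P⟫_ℝ ≠ 0 := inner_self_ne_zero.2 hpx
  have hden : Filter.Tendsto (fun t => ⟪P, p (x + ζ t)⟫_ℝ) l (nhds ⟪P, P⟫_ℝ) :=
    tendsto_const_nhds.inner hpζ
  set m : ℝ → ℝ := fun t =>
    ⟪P, r • P + t • (η + r • A η) - ζ t⟫_ℝ / ⟪P, p (x + ζ t)⟫_ℝ with hm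
  have hmlim : Filter.Tendsto m l (nhds r) := by
    have h1 : Filter.Tendsto (fun t => r • P + t • (η + r • A η) - ζ t) l (nhds (r • P)) := by
      simpa using ((ht0.smul_const (η + r • A η)).const_add (r • P)).sub hζ0
    have h2 := (tendsto_const_nhds (x := P)).inner h1 |>.div hden hPP
    rwa [inner_smul_right, mul_div_cancel_right₀ _ hPP] at h2
  have hmeq : ∀ᶠ t in l, r • P + t • (η + r • A η) - ζ t = m t • p (x + ζ t) := by
    filter_upwards [hcontact, hden.eventually_ne hPP] with t ⟨μ, hμ⟩ hne
    have : m t = μ := by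
      rw [hm]
      simp only
      rw [hμ, inner_smul_right, mul_div_cancel_right₀ _ hne]
    rw [this, hμ]
  set w : ℝ → E := fun t => t⁻¹ • ζ t with hw
  have hwb : ∀ᶠ t in l, ‖w t‖ ≤ C := by
    filter_upwards [htpos] with t ht
    rw [hw]
    simp only
    rw [norm_smul, norm_inv, Real.norm_eq_abs, inv_mul_le_iff₀ (abs_pos.2 ht.ne'), mul_comm]
    exact hζ t
  set err : ℝ → E := fun t =>
    (m t - r) • A (w t) + m t • (t⁻¹ • (p (x + ζ t) - P - A (ζ t))) with herr
  have herr0 : Filter.Tendsto err l (nhds 0) := by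
    have h1 : Filter.Tendsto (fun t => (m t - r) • A (w t)) l (nhds 0) := by
      have h0 : Filter.Tendsto (fun t => m t - r) l (nhds 0) := by
        simpa using hmlim.sub_const r
      refine squeeze_zero_norm' (a := fun t => |m t - r| * (‖A‖ * C)) ?_ ?_
      · filter_upwards [hwb] with t ht
        rw [norm_smul, Real.norm_eq_abs]
        gcongr
        exact A.le_opNorm_of_le ht
      · simpa using h0.abs.mul_const (‖A‖ * C)
    simpa using h1.add (hmlim.smul hR')
  set q : ℝ → E := fun t => (⟪P, w t⟫_ℝ / ⟪P, P⟫_ℝ) • P with hq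
  have hPw : Filter.Tendsto (fun t => ⟪P, w t⟫_ℝ) l (nhds 0) := by
    refine squeeze_zero_norm' (a := fun t => C * t) ?_ (by simpa using ht0.const_mul C)
    filter_upwards [htpos] with t ht
    rw [hw]
    simp only
    rw [inner_smul_right, norm_mul, norm_inv, Real.norm_eq_abs, Real.norm_eq_abs,
      abs_of_pos ht, inv_mul_le_iff₀ ht]
    linarith [hζp t]
  have hq0 : Filter.Tendsto q l (nhds 0) := by
    have := (hPw.div_const ⟪P, P⟫_ℝ).smul_const P
    rwa [zero_div, zero_smul] at this
  set δ : ℝ → E := fun t => w t - η - q t with hδ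
  have hδP : ∀ t, ⟪P, δ t⟫_ℝ = 0 := fun t => by
    simp only [hδ, hq, inner_sub_right, inner_smul_right, hη]
    field_simp
    ring
  have hδle : ∀ᶠ t in l, ‖δ t‖ ≤ 2 * ‖err t + (q t + r • A (q t))‖ := by
    filter_upwards [hmeq, htpos] with t hmt ht
    have h1 : t⁻¹ • (r • P + t • (η + r • A η) - ζ t) =
        t⁻¹ • (m t • P) + (m t • A (w t) +
          m t • (t⁻¹ • (p (x + ζ t) - P - A (ζ t)))) := by
      rw [hmt]
      simp only [hw, map_smul]
      module
    have h2 : (η + r • A η) - w t - r • A (w t) = (t⁻¹ * (m t - r)) • P + err t := by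
      have h3 : t⁻¹ • t • (η + r • A η) = η + r • A η := inv_smul_smul₀ ht.ne' _
      have h4 : (η + r • A η) - w t = t⁻¹ • (r • P + t • (η + r • A η) - ζ t) -
          (t⁻¹ * r) • P := by
        rw [smul_sub, smul_add, h3, hw]
        module
      rw [h4, h1, herr]
      module
    have h5 : w t = δ t + η + q t := by simp only [hδ]; abel
    have h6 : δ t + r • A (δ t) =
        -((t⁻¹ * (m t - r)) • P) - (err t + (q t + r • A (q t))) := by
      rw [h5] at h2
      simp only [map_add, smul_add] at h2
      rw [← sub_eq_zero] at h2 ⊢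
      rw [← h2]
      have h7 := neg_eq_zero.2 h2
      rw [h2, ← h7]
      abel
    have h7 : ⟪δ t + r • A (δ t), δ t⟫_ℝ = -⟪err t + (q t + r • A (q t)), δ t⟫_ℝ := by
      rw [h6, inner_sub_left, inner_neg_left, inner_smul_left, hδP]
      simp
    have h8 : |⟪r • A (δ t), δ t⟫_ℝ| ≤ 1 / 2 * ‖δ t‖ ^ 2 := by
      calc |⟪r • A (δ t), δ t⟫_ℝ| ≤ ‖r • A (δ t)‖ * ‖δ t‖ := abs_real_inner_le_norm _ _
        _ ≤ (|r| * (‖A‖ * ‖δ t‖)) * ‖δ t‖ := by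
          rw [norm_smul, Real.norm_eq_abs]
          gcongr
          exact A.le_opNorm _
        _ = (|r| * ‖A‖) * ‖δ t‖ ^ 2 := by ring
        _ ≤ 1 / 2 * ‖δ t‖ ^ 2 := by gcongr
    have h9 := abs_real_inner_le_norm (err t + (q t + r • A (q t))) (δ t)
    rw [inner_add_left, real_inner_self_eq_norm_sq] at h7
    have h10 := (abs_le.1 h8).1
    have h11 := (abs_le.1 h9).1
    rcases (norm_nonneg (δ t)).eq_or_lt with h0 | hpos
    · rw [← h0]; positivity
    · refine le_of_mul_le_mul_right ?_ hpos
      nlinarith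
  have hδ0 : Filter.Tendsto δ l (nhds 0) := by
    refine squeeze_zero_norm' hδle ?_
    have h1 : Filter.Tendsto (fun t => err t + (q t + r • A (q t))) l (nhds 0) := by
      simpa using herr0.add (hq0.add (((A.continuous.tendsto 0).comp hq0).const_smul r))
    simpa using h1.norm.const_mul 2
  have hfin : Filter.Tendsto (fun t => δ t + η + q t) l (nhds η) := by
    simpa using (hδ0.add_const η).add hq0
  refine hfin.congr fun t => ?_
  simp only [hδ]
  abel

/-- If the bilinear form of `T` has nonpositive cyclic sums along all loops orthogonal to `P`, then
it is symmetric on the orthogonal complement of `P`. -/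
theorem inner_le_inner_of_loops {T : E →L[ℝ] E} {P e f : E}
    (hloop : ∀ (η : ℕ → E) (N : ℕ), (∀ k, ⟪P, η k⟫_ℝ = 0) → η N = η 0 →
      ∑ k ∈ Finset.range N, ⟪T (η (k + 1) - η k), η k⟫_ℝ ≤ 0)
    (he : ⟪P, e⟫_ℝ = 0) (hf : ⟪P, f⟫_ℝ = 0) : ⟪T f, e⟫_ℝ ≤ ⟪T e, f⟫_ℝ := by
  by_contra! hlt
  set D := ⟪T f, e⟫_ℝ - ⟪T e, f⟫_ℝ with hD
  have hDpos : 0 < D := sub_pos.2 hlt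
  set S := ⟪T f, e⟫_ℝ + ⟪T e, f⟫_ℝ with hS
  set a := ⟪T e, e⟫_ℝ
  set b := ⟪T f, f⟫_ℝ
  set C := (|a| + |b| + |S|) / 2 with hC
  have hkey : ∀ N : ℕ, 0 < N → 1 / 2 * D * Real.sin (2 * Real.pi / N) ≤
      C * (2 * Real.pi / N) ^ 2 := by
    intro N hN
    set θ := 2 * Real.pi / N with hθ
    have hNθ : (N : ℝ) * θ = 2 * Real.pi := by
      rw [hθ]; field_simp
    set G : ℕ → ℝ := fun k => 1 / 2 * Real.cos (k * θ) ^ 2 * a + 1 / 2 * Real.sin (k * θ) ^ 2 * b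
      + 1 / 2 * S * (Real.sin (k * θ) * Real.cos (k * θ)) with hG
    have hterm : ∀ k : ℕ, 1 / 2 * D * Real.sin θ - C * θ ^ 2 + (G (k + 1) - G k) ≤
        ⟪T ((Real.cos ((k + 1 : ℕ) * θ) • e + Real.sin ((k + 1 : ℕ) * θ) • f) -
          (Real.cos (k * θ) • e + Real.sin (k * θ) • f)),
          Real.cos (k * θ) • e + Real.sin (k * θ) • f⟫_ℝ := by
      intro k
      have hstep : ((k + 1 : ℕ) : ℝ) * θ - k * θ = θ := by push_cast; ring
      have hs := Real.abs_sin_sub_sin_le ((k + 1 : ℕ) * θ) (k * θ)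
      have hc := Real.abs_cos_sub_cos_le ((k + 1 : ℕ) * θ) (k * θ)
      have hsin := Real.sin_sub ((k + 1 : ℕ) * θ) (k * θ)
      rw [hstep] at hs hc hsin
      simp only [hG]
      rw [hsin]
      simp only [map_sub, map_add, map_smul, inner_sub_left, inner_add_left, inner_add_right,
        inner_smul_left, inner_smul_right, conj_trivial]
      generalize Real.cos ((k + 1 : ℕ) * θ) = c' at *
      generalize Real.sin ((k + 1 : ℕ) * θ) = s' at *
      generalize Real.cos (k * θ) = c at *
      generalize Real.sin (k * θ) = s at *
      have h1 : (c' - c) ^ 2 ≤ θ ^ 2 := sq_le_sq.2 hc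
      have h2 : (s' - s) ^ 2 ≤ θ ^ 2 := sq_le_sq.2 hs
      have h3 : |(s' - s) * (c' - c)| ≤ θ ^ 2 := by
        rw [abs_mul, ← sq_abs θ, sq]
        exact mul_le_mul hs hc (abs_nonneg _) (abs_nonneg _)
      have ha : (c' - c) ^ 2 * a ≤ θ ^ 2 * |a| :=
        (mul_le_mul_of_nonneg_left (le_abs_self a) (sq_nonneg _)).trans
          (mul_le_mul_of_nonneg_right h1 (abs_nonneg a))
      have hb : (s' - s) ^ 2 * b ≤ θ ^ 2 * |b| :=
        (mul_le_mul_of_nonneg_left (le_abs_self b) (sq_nonneg _)).trans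
          (mul_le_mul_of_nonneg_right h2 (abs_nonneg b))
      have hS' : (s' - s) * (c' - c) * S ≤ θ ^ 2 * |S| := by
        refine (le_abs_self _).trans ?_
        rw [abs_mul]
        exact mul_le_mul_of_nonneg_right h3 (abs_nonneg S)
      have e1 : ⟪T f, e⟫_ℝ = (S + D) / 2 := by rw [hS, hD]; ring
      have e2 : ⟪T e, f⟫_ℝ = (S - D) / 2 := by rw [hS, hD]; ring
      rw [e1, e2, hC]
      linarith
    have hsum := hloop (fun k => Real.cos (k * θ) • e + Real.sin (k * θ) • f) N
      (fun k => by simp [inner_add_right, inner_smul_right, he, hf]) (by simp [hNθ])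
    have h1 := (Finset.sum_le_sum fun k (_ : k ∈ Finset.range N) => hterm k).trans hsum
    rw [Finset.sum_add_distrib, Finset.sum_range_sub, Finset.sum_const, Finset.card_range] at h1
    have h2 : G N = G 0 := by simp [hG, hNθ]
    rw [h2, sub_self, add_zero, nsmul_eq_mul] at h1
    have h3 := nonpos_of_mul_nonpos_right h1 (by exact_mod_cast hN)
    linarith
  have hlim : Filter.Tendsto (fun N : ℕ => 2 * Real.pi / (N : ℝ)) Filter.atTop (nhds 0) :=
    tendsto_const_div_atTop_nhds_zero_nat _
  have hC0 : 0 ≤ C := by positivity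
  have hev := hlim.eventually (gt_mem_nhds (show (0 : ℝ) < min (Real.pi / 2)
    (D / (Real.pi * (C + 1))) by have := Real.pi_pos; positivity))
  obtain ⟨N, hN1, hN2⟩ := (hev.and (Filter.eventually_gt_atTop 0)).exists
  have h1 := hkey N hN2
  have hθpos : 0 < 2 * Real.pi / (N : ℝ) := by
    have := Real.pi_pos
    positivity
  obtain ⟨h2, h3⟩ := lt_min_iff.1 hN1
  set θ := 2 * Real.pi / (N : ℝ)
  have h4 := Real.mul_le_sin hθpos.le h2.le
  rw [lt_div_iff₀ (by have := Real.pi_pos; positivity)] at h3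
  have h5 : 1 / 2 * D * (2 / Real.pi * θ) ≤ C * θ ^ 2 :=
    (mul_le_mul_of_nonneg_left h4 (by positivity)).trans h1
  have h6 : D * θ ≤ Real.pi * C * θ * θ := by
    have := mul_le_mul_of_nonneg_left h5 Real.pi_pos.le
    field_simp at this
    nlinarith
  have h7 := le_of_mul_le_mul_right h6 hθpos
  nlinarith [mul_pos Real.pi_pos hθpos]

/-- If a compact set has all its proximal normals near `x` parallel to `p`, and a nonzero proximal
normal at `x`, then the derivative of `p` at `x` is symmetric on the orthogonal complement of
`p x`. -/
theorem inner_comm_of_proximal_normals {K : Set E} (hK : IsCompact K) {x q : E} (hx : x ∈ K)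
    (hqx : q ≠ x) (hq : ∀ z ∈ K, ‖q - x‖ ≤ ‖q - z‖) {p : E → E} {A : E →L[ℝ] E}
    (hp : HasFDerivAt p A x) (hpx : p x ≠ 0)
    (hcontact : ∀ᶠ z in nhds x, z ∈ K → ∀ y, (∀ z' ∈ K, ‖y - z‖ ≤ ‖y - z'‖) →
      ∃ μ : ℝ, y - z = μ • p z)
    {e f : E} (he : ⟪p x, e⟫_ℝ = 0) (hf : ⟪p x, f⟫_ℝ = 0) : ⟪A f, e⟫_ℝ = ⟪A e, f⟫_ℝ := by
  obtain ⟨μ, hμ⟩ := hcontact.self_of_nhds hx q hq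
  have hμ0 : μ ≠ 0 := by
    rintro rfl
    exact hqx (by simpa [sub_eq_zero] using hμ)
  obtain ⟨τ, hτ, hτ2, hτA⟩ : ∃ τ : ℝ, 0 < τ ∧ τ ≤ 1 / 2 ∧ |τ * μ| * ‖A‖ ≤ 1 / 2 := by
    have hden : 0 < 2 * (|μ| * ‖A‖ + 1) := by positivity
    have h0 : 0 ≤ |μ| * ‖A‖ := by positivity
    refine ⟨1 / (2 * (|μ| * ‖A‖ + 1)), by positivity, ?_, ?_⟩
    · exact one_div_le_one_div_of_le (by norm_num) (by linarith)
    · rw [abs_mul, abs_of_pos (by positivity), mul_assoc, div_mul_eq_mul_div,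
        div_le_iff₀ hden]
      linarith
  have hnear : ∀ y, ∃ z ∈ K, ∀ z' ∈ K, ‖y - z‖ ≤ ‖y - z'‖ := fun y =>
    (hK.exists_isMinOn ⟨x, hx⟩ (f := fun z => ‖y - z‖) (by fun_prop)).imp fun z hz =>
      ⟨hz.1, fun z' hz' => hz.2 hz'⟩
  choose π hπK hπ using hnear
  set r := τ * μ with hr
  have hr0 : r ≠ 0 := mul_ne_zero hτ.ne' hμ0
  set ζ : E → E := fun h => π (x + r • p x + h) - x with hζ
  have hball : ∀ h, 2 * (μ * ⟪p x, ζ h⟫_ℝ) ≤ ‖ζ h‖ ^ 2 := by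
    intro h
    have h1 := hq _ (hπK (x + r • p x + h))
    have h2 : q - π (x + r • p x + h) = μ • p x - ζ h := by
      rw [← hμ]; simp only [hζ]; abel
    rw [h2, hμ] at h1
    have h3 := pow_le_pow_left₀ (norm_nonneg _) h1 2
    rw [norm_sub_sq_real, inner_smul_left, conj_trivial] at h3
    linarith
  have hproj : ∀ h, ‖ζ h‖ ^ 2 ≤ 2 * (r * ⟪p x, ζ h⟫_ℝ) + 2 * ⟪h, ζ h⟫_ℝ := by
    intro h
    have h1 := hπ (x + r • p x + h) x hx
    have h2 : x + r • p x + h - π (x + r • p x + h) = (r • p x + h) - ζ h := by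
      simp only [hζ]; abel
    have h3 : x + r • p x + h - x = r • p x + h := by abel
    rw [h2, h3] at h1
    have h3 := pow_le_pow_left₀ (norm_nonneg _) h1 2
    rw [norm_sub_sq_real, inner_add_left, inner_smul_left, conj_trivial] at h3
    linarith
  have hζ4 : ∀ h, ‖ζ h‖ ≤ 4 * ‖h‖ := by
    intro h
    have h1 := mul_le_mul_of_nonneg_left (hball h) hτ.le
    have h2 := hproj h
    have h3 := real_inner_le_norm h (ζ h)
    have h4 := mul_le_mul_of_nonneg_right hτ2 (sq_nonneg ‖ζ h‖)
    rcases (norm_nonneg (ζ h)).eq_or_lt with h0 | hpos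
    · rw [← h0]; positivity
    · refine le_of_mul_le_mul_right ?_ hpos
      rw [hr] at h2
      nlinarith
  have hζp : ∀ h, |⟪p x, ζ h⟫_ℝ| ≤ 8 / (τ * |μ|) * ‖h‖ ^ 2 := by
    intro h
    have h1 := hball h
    have h2 := hproj h
    have h3 := real_inner_le_norm h (ζ h)
    have h4 := hζ4 h
    have h5 : ‖ζ h‖ ^ 2 ≤ 16 * ‖h‖ ^ 2 := by
      nlinarith [norm_nonneg (ζ h), norm_nonneg h]
    have h6 : ‖h‖ * ‖ζ h‖ ≤ 4 * ‖h‖ ^ 2 := by nlinarith [norm_nonneg h]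
    have h7 : |r * ⟪p x, ζ h⟫_ℝ| ≤ 8 * ‖h‖ ^ 2 := by
      rw [abs_le]
      constructor
      · nlinarith [sq_nonneg ‖ζ h‖]
      · have h8 := mul_le_mul_of_nonneg_left h1 hτ.le
        have h9 := mul_le_mul_of_nonneg_right hτ2 (sq_nonneg ‖ζ h‖)
        rw [hr]
        nlinarith [sq_nonneg ‖h‖]
    rw [div_mul_eq_mul_div, le_div_iff₀ (by positivity), ← abs_of_pos hτ, ← abs_mul, ← hr,
      ← abs_mul, mul_comm]
    exact h7
  set T : E →L[ℝ] E := ContinuousLinearMap.id ℝ E + r • A with hT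
  have hTapp : ∀ η, T η = η + r • A η := fun η => by simp [hT]
  have hlim : ∀ η, ⟪p x, η⟫_ℝ = 0 → Filter.Tendsto (fun t : ℝ => t⁻¹ • ζ (t • T η))
      (nhdsWithin (0 : ℝ) (Set.Ioi 0)) (nhds η) := by
    intro η hη
    have hb1 : ∀ t : ℝ, ‖ζ (t • T η)‖ ≤ 4 * ‖T η‖ * |t| := fun t => by
      have := hζ4 (t • T η)
      rw [norm_smul, Real.norm_eq_abs] at this
      linarith
    have hb2 : ∀ t : ℝ, |⟪p x, ζ (t • T η)⟫_ℝ| ≤ 8 / (τ * |μ|) * ‖T η‖ ^ 2 * t ^ 2 := fun t => by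
      have := hζp (t • T η)
      rw [norm_smul, Real.norm_eq_abs, mul_pow, sq_abs] at this
      linarith
    refine tendsto_nearest_displacement (C := max (4 * ‖T η‖) (8 / (τ * |μ|) * ‖T η‖ ^ 2))
      hp hpx hτA hη (fun t => (hb1 t).trans ?_) (fun t => (hb2 t).trans ?_) ?_
    · gcongr
      exact le_max_left _ _
    · gcongr
      exact le_max_right _ _
    · have h0 : Filter.Tendsto (fun t : ℝ => x + ζ (t • T η)) (nhdsWithin (0 : ℝ) (Set.Ioi 0))
          (nhds x) := by
        have h1 : Filter.Tendsto (fun t : ℝ => ζ (t • T η)) (nhds 0) (nhds 0) :=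
          squeeze_zero_norm hb1 (by
            have : Continuous fun t : ℝ => 4 * ‖T η‖ * |t| := by fun_prop
            simpa using this.tendsto 0)
        simpa using (h1.mono_left nhdsWithin_le_nhds).const_add x
      filter_upwards [h0.eventually hcontact] with t ht
      have h1 : x + ζ (t • T η) = π (x + r • p x + t • T η) := by simp [hζ]
      rw [h1] at ht
      obtain ⟨ν, hν⟩ := ht (hπK _) _ (hπ _)
      refine ⟨ν, ?_⟩
      rw [h1, ← hν, ← hTapp]
      simp only [hζ]
      abel
  have hcyc : ∀ h h', ⟪h' - h, ζ h⟫_ℝ ≤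
      (⟪r • p x + h', ζ h'⟫_ℝ - ‖ζ h'‖ ^ 2 / 2) - (⟪r • p x + h, ζ h⟫_ℝ - ‖ζ h‖ ^ 2 / 2) := by
    intro h h'
    have h1 := hπ (x + r • p x + h') _ (hπK (x + r • p x + h))
    have h2 : ∀ k, x + r • p x + h' - π (x + r • p x + k) = (r • p x + h') - ζ k := fun k => by
      simp only [hζ]; abel
    rw [h2, h2] at h1
    have h3 := pow_le_pow_left₀ (norm_nonneg _) h1 2
    rw [norm_sub_sq_real (r • p x + h') (ζ h'), norm_sub_sq_real (r • p x + h') (ζ h)] at h3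
    simp only [inner_sub_left, inner_add_left] at h3 ⊢
    linarith
  have hloop : ∀ (η : ℕ → E) (N : ℕ), (∀ k, ⟪p x, η k⟫_ℝ = 0) → η N = η 0 →
      ∑ k ∈ Finset.range N, ⟪T (η (k + 1) - η k), η k⟫_ℝ ≤ 0 := by
    intro η N hη hN
    have h1 : Filter.Tendsto (fun t : ℝ => ∑ k ∈ Finset.range N,
        ⟪T (η (k + 1) - η k), t⁻¹ • ζ (t • T (η k))⟫_ℝ) (nhdsWithin (0 : ℝ) (Set.Ioi 0))
        (nhds (∑ k ∈ Finset.range N, ⟪T (η (k + 1) - η k), η k⟫_ℝ)) :=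
      tendsto_finsetSum _ fun k _ => tendsto_const_nhds.inner (hlim (η k) (hη k))
    refine le_of_tendsto h1 ?_
    filter_upwards [self_mem_nhdsWithin] with t (ht : 0 < t)
    have h2 : ∀ k, ⟪T (η (k + 1) - η k), t⁻¹ • ζ (t • T (η k))⟫_ℝ =
        (t⁻¹) ^ 2 * ⟪t • T (η (k + 1)) - t • T (η k), ζ (t • T (η k))⟫_ℝ := by
      intro k
      rw [← smul_sub, ← map_sub, inner_smul_left, inner_smul_right, conj_trivial]
      field_simp
    simp only [h2]
    rw [← Finset.mul_sum]
    refine mul_nonpos_of_nonneg_of_nonpos (sq_nonneg _) ?_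
    refine (Finset.sum_le_sum fun k _ => hcyc (t • T (η k)) (t • T (η (k + 1)))).trans ?_
    rw [Finset.sum_range_sub (fun k => ⟪r • p x + t • T (η k), ζ (t • T (η k))⟫_ℝ -
      ‖ζ (t • T (η k))‖ ^ 2 / 2), hN, sub_self]
  have hsymm := le_antisymm (inner_le_inner_of_loops hloop he hf)
    (inner_le_inner_of_loops hloop hf he)
  simp only [hTapp, inner_add_left, inner_smul_left, conj_trivial, real_inner_comm e f] at hsymm
  have h1 : r * ⟪A f, e⟫_ℝ = r * ⟪A e, f⟫_ℝ := by linarith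
  exact mul_left_cancel₀ hr0 h1

end NearestPoint

theorem exists_ne_zero_dotProduct_pair_eq_zero {N : ℕ} (hN : 2 < N) (a b : Fin N → ℝ) :
    ∃ e : Fin N → ℝ, e ≠ 0 ∧ a ⬝ᵥ e = 0 ∧ b ⬝ᵥ e = 0 := by
  obtain ⟨e, he, he0⟩ := (Submodule.ne_bot_iff _).1
    (LinearMap.ker_ne_bot_of_finrank_lt (f := Matrix.mulVecLin (Matrix.of ![a, b])) (by simpa))
  have h := congrFun (LinearMap.mem_ker.1 he)
  exact ⟨e, he0, by simpa using h 0, by simpa using h 1⟩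

theorem exists_smul_of_rotVec {N : ℕ} {P d : Fin N → ℝ} (hP : P ≠ 0)
    (h : ∀ k l, d ⬝ᵥ rotVec P k l = 0) : ∃ μ : ℝ, d = μ • P := by
  obtain ⟨k, hk⟩ := Function.ne_iff.mp hP
  have hk : P k ≠ 0 := hk
  refine ⟨d k / P k, funext fun l => ?_⟩
  have := h k l
  simp only [rotVec, dotProduct_sub, dotProduct_smul, smul_eq_mul, ee_eq_single,
    dotProduct_single_one] at this
  simp only [Pi.smul_apply, smul_eq_mul]
  field_simp
  linarith

/-- The derivative of `∇u + F` is not symmetric on the orthogonal complement of any vector. -/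
theorem exists_gradFDeriv_not_symm {n : ℕ} (hn : 2 ≤ n)
    {B : (Fin (2 * n) → ℝ) →L[ℝ] (Fin (2 * n) → ℝ) →L[ℝ] ℝ} (hB : ∀ a b, B a b = B b a)
    (P : Fin (2 * n) → ℝ) :
    ∃ e f, P ⬝ᵥ e = 0 ∧ P ⬝ᵥ f = 0 ∧ gradFDeriv n B f ⬝ᵥ e ≠ gradFDeriv n B e ⬝ᵥ f := by
  obtain ⟨e, he0, he, hJe⟩ :=
    exists_ne_zero_dotProduct_pair_eq_zero (by omega : 2 < 2 * n) P (heisF n P)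
  refine ⟨e, heisF n e, he, ?_, ?_⟩
  · rw [dotProduct_comm, heisF_dotProduct_skew, hJe, neg_zero]
  · have h1 : heisF n (heisF n e) ⬝ᵥ e = -(e ⬝ᵥ e) := by rw [heisF_heisF, neg_dotProduct]
    have h2 : heisF n e ⬝ᵥ heisF n e = e ⬝ᵥ e := by
      rw [heisF_dotProduct_skew n e (heisF n e), h1, neg_neg]
    rw [gradFDeriv_dotProduct, gradFDeriv_dotProduct, h1, h2, hB e]
    have h3 : e ⬝ᵥ e ≠ 0 := fun h => he0 (dotProduct_self_eq_zero.1 h)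
    have h4 : 0 ≤ e ⬝ᵥ e := Finset.sum_nonneg fun i _ => mul_self_nonneg _
    intro h
    exact h3 (by linarith)

/-- The barrier function of a ball touching at `z` with normal direction `d`. -/
def ballBarrier {N : ℕ} (d z ξ : Fin N → ℝ) : ℝ :=
  ∑ i, (d i * (ξ i - z i) - (ξ i - z i) ^ 2)

theorem contDiff_ballBarrier {N : ℕ} (d z : Fin N → ℝ) : ContDiff ℝ 2 (ballBarrier d z) := by
  unfold ballBarrier
  fun_prop

theorem fderiv_ballBarrier {N : ℕ} (d z a : Fin N → ℝ) :
    fderiv ℝ (ballBarrier d z) z a = d ⬝ᵥ a := by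
  have hcoord : ∀ i : Fin N, HasFDerivAt (fun ξ : Fin N → ℝ => ξ i - z i)
      (ContinuousLinearMap.proj (R := ℝ) (φ := fun _ : Fin N => ℝ) i) z := fun i =>
    (ContinuousLinearMap.proj (R := ℝ) (φ := fun _ : Fin N => ℝ) i).hasFDerivAt.sub_const _
  have h : HasFDerivAt (ballBarrier d z) _ z := HasFDerivAt.fun_sum (u := Finset.univ) fun i _ =>
    ((hcoord i).const_mul (d i)).sub ((hcoord i).pow 2)
  rw [h.fderiv]
  simp [dotProduct]

theorem eventually_eq_of_touching {n : ℕ} (hn : 2 ≤ n) {U : Set (Fin (2 * n) → ℝ)}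
    (hU : IsOpen U) {u v : (Fin (2 * n) → ℝ) → ℝ}
    (hu : ContDiffOn ℝ 2 u U) (hv : ContDiffOn ℝ 2 v U)
    (hns_u : ∀ x ∈ U, gradF (2 * n) (heisF n) u x ≠ 0)
    (hns_v : ∀ x ∈ U, gradF (2 * n) (heisF n) v x ≠ 0)
    (hH : ∀ x ∈ U, Hmc (2 * n) (heisF n) u x ≤ Hmc (2 * n) (heisF n) v x)
    (huv : ∀ x ∈ U, v x ≤ u x) {p₀ : Fin (2 * n) → ℝ} (hp₀ : p₀ ∈ U) (htouch : u p₀ = v p₀) :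
    ∀ᶠ y in nhds p₀, u y = v y := by
  by_contra hcon
  have hud : ∀ x ∈ U, ContDiffAt ℝ 2 u x := fun x hx => hu.contDiffAt (hU.mem_nhds hx)
  have hvd : ∀ x ∈ U, ContDiffAt ℝ 2 v x := fun x hx => hv.contDiffAt (hU.mem_nhds hx)
  set L := EuclideanSpace.equiv (Fin (2 * n)) ℝ with hL
  have hinner : ∀ a b : Fin (2 * n) → ℝ, inner ℝ (L.symm a) (L.symm b) = a ⬝ᵥ b := fun a b => by
    rw [EuclideanSpace.inner_eq_star_dotProduct, dotProduct_comm]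
    rfl
  obtain ⟨R, hR, hRU⟩ := Metric.nhds_basis_closedBall.mem_iff.1
    ((hU.preimage L.continuous).mem_nhds
      (show L.symm p₀ ∈ L ⁻¹' U by simpa using hp₀))
  set K : Set (EuclideanSpace ℝ (Fin (2 * n))) :=
    Metric.closedBall (L.symm p₀) R ∩ {ξ | u (L ξ) - v (L ξ) = 0} with hK
  have hKc : IsCompact K := by
    refine (isCompact_closedBall (L.symm p₀) R).of_isClosed_subset ?_ Set.inter_subset_left
    have hc : ContinuousOn (fun ξ => u (L ξ) - v (L ξ)) (Metric.closedBall (L.symm p₀) R) :=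
      (hu.continuousOn.sub hv.continuousOn).comp L.continuous.continuousOn hRU
    exact hc.preimage_isClosed_of_isClosed Metric.isClosed_closedBall isClosed_singleton
  have hp₀K : L.symm p₀ ∈ K :=
    ⟨Metric.mem_closedBall_self hR.le, by simp [htouch]⟩
  obtain ⟨q, hqne, hqball⟩ : ∃ q, u (L q) ≠ v (L q) ∧ dist q (L.symm p₀) < R / 2 := by
    have h1 : ∃ᶠ y in nhds p₀, u y ≠ v y := Filter.not_eventually.1 hcon
    have h2 : ∀ᶠ y in nhds p₀, dist (L.symm y) (L.symm p₀) < R / 2 :=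
      L.symm.continuous.continuousAt.eventually (Metric.ball_mem_nhds _ (half_pos hR))
    obtain ⟨y, hy1, hy2⟩ := (h1.and_eventually h2).exists
    exact ⟨L.symm y, by simpa using hy1, hy2⟩
  obtain ⟨x, hxK, hxmin⟩ := hKc.exists_isMinOn ⟨_, hp₀K⟩
    (f := fun z => ‖q - z‖) (by fun_prop)
  have hxball : x ∈ Metric.ball (L.symm p₀) R := by
    have h1 : ‖q - x‖ ≤ ‖q - L.symm p₀‖ := hxmin hp₀K
    rw [← dist_eq_norm, ← dist_eq_norm] at h1
    have h2 := dist_triangle_left x (L.symm p₀) q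
    rw [Metric.mem_ball]
    linarith
  have hxU : L x ∈ U := hRU hxK.1
  have hqx : q ≠ x := by
    rintro rfl
    exact hqne (sub_eq_zero.1 hxK.2)
  set p : EuclideanSpace ℝ (Fin (2 * n)) → EuclideanSpace ℝ (Fin (2 * n)) :=
    fun ξ => L.symm (gradF (2 * n) (heisF n) u (L ξ)) with hp
  have hpd : HasFDerivAt p ((L.symm : (Fin (2 * n) → ℝ) →L[ℝ] _).comp
      ((gradFDeriv n (hess u (L x))).comp (L : _ →L[ℝ] (Fin (2 * n) → ℝ)))) x :=
    L.symm.hasFDerivAt.comp x ((hasFDerivAt_gradF (hud _ hxU)).comp x L.hasFDerivAt)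
  have hpx : p x ≠ 0 := fun h => hns_u _ hxU (by simpa [hp] using h)
  have hcontact : ∀ᶠ z in nhds x, z ∈ K → ∀ y, (∀ z' ∈ K, ‖y - z‖ ≤ ‖y - z'‖) →
      ∃ μ : ℝ, y - z = μ • p z := by
    filter_upwards [Metric.isOpen_ball.mem_nhds hxball] with z hz hzK y hy
    have hzU : L z ∈ U := hRU hzK.1
    have hUz := hU.mem_nhds hzU
    have hrot : ∀ k l, (L y - L z) ⬝ᵥ rotVec (gradF (2 * n) (heisF n) u (L z)) k l = 0 := by
      intro k l
      rw [← fderiv_ballBarrier _ (L z)]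
      refine fderiv_rotVec_eq_zero_of_contact (hud _ hzU) (hvd _ hzU)
        (contDiff_ballBarrier _ _).contDiffAt (hasFDerivAt_gradF (hud _ hzU)).continuousAt
        (hasFDerivAt_gradF (hvd _ hzU)).continuousAt (hns_u _ hzU) ?_ ?_ ?_
        (sub_eq_zero.1 hzK.2) (by simp [ballBarrier]) ?_ k l
      · exact .of_forall fun ξ i => by simp [gradF, pd]
      · filter_upwards [hUz] with ξ hξ
        rw [← Hmc_eq_mcOp (hud ξ hξ) (hns_u ξ hξ), ← Hmc_eq_mcOp (hvd ξ hξ) (hns_v ξ hξ)]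
        exact hH ξ hξ
      · filter_upwards [hUz] with ξ hξ using huv ξ hξ
      · have hev : ∀ᶠ ξ in nhds (L z), L.symm ξ ∈ Metric.ball (L.symm p₀) R :=
          L.symm.continuous.continuousAt.eventually
            (Metric.isOpen_ball.mem_nhds (by simpa using hz))
        filter_upwards [hev] with ξ hξ hξeq hξne
        have h1 := hy (L.symm ξ) ⟨Metric.ball_subset_closedBall hξ, by simp [hξeq]⟩
        have h2 := pow_le_pow_left₀ (norm_nonneg _) h1 2
        rw [EuclideanSpace.real_norm_sq_eq, EuclideanSpace.real_norm_sq_eq] at h2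
        have h3 : ∑ i, (L y i - L z i) ^ 2 ≤ ∑ i, (L y i - ξ i) ^ 2 := h2
        have h4 : 0 < ∑ i, (ξ i - L z i) ^ 2 := sum_sq_pos (P := ξ - L z) (sub_ne_zero.2 hξne)
        have h5 : ∑ i, (L y i - ξ i) ^ 2 = ∑ i, (L y i - L z i) ^ 2 +
            2 * ballBarrier (L y - L z) (L z) ξ * (-1) - ∑ i, (ξ i - L z i) ^ 2 := by
          simp only [ballBarrier, Finset.mul_sum, Finset.sum_mul, ← Finset.sum_add_distrib,
            ← Finset.sum_sub_distrib, Pi.sub_apply]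
          exact Finset.sum_congr rfl fun i _ => by ring
        linarith
    obtain ⟨μ, hμ⟩ := exists_smul_of_rotVec (hns_u _ hzU) hrot
    refine ⟨μ, L.injective ?_⟩
    rw [map_sub, hμ, map_smul, hp, L.apply_symm_apply]
  have hsymm : ∀ a b, hess u (L x) a b = hess u (L x) b a := fun a b =>
    (hud _ hxU).isSymmSndFDerivAt (by simp) a b
  obtain ⟨e, f, he, hf, hne⟩ := exists_gradFDeriv_not_symm hn hsymm
    (gradF (2 * n) (heisF n) u (L x))
  have := inner_comm_of_proximal_normals hKc hxK hqx (fun z hz => hxmin hz) hpd hpx hcontact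
    (e := L.symm e) (f := L.symm f) (by rw [hp, hinner, he]) (by rw [hp, hinner, hf])
  simp only [ContinuousLinearMap.comp_apply, ContinuousLinearEquiv.coe_coe,
    ContinuousLinearEquiv.apply_symm_apply, hinner] at this
  exact hne this

/-- Corollary I: strong maximum principle for the horizontal
(p-)mean curvature of graphs in the Heisenberg group `H_n`, `2n ≥ 4`. -/
theorem strong_max_principle_heisenberg_graphs
    (n : ℕ) (hn : 2 ≤ n)
    (U : Set (Fin (2 * n) → ℝ)) (hUopen : IsOpen U) (hUconn : IsConnected U)
    (u v : (Fin (2 * n) → ℝ) → ℝ)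
    (hu : ContDiffOn ℝ 2 u U) (hv : ContDiffOn ℝ 2 v U)
    (hns_u : ∀ x ∈ U, gradF (2 * n) (heisF n) u x ≠ 0)
    (hns_v : ∀ x ∈ U, gradF (2 * n) (heisF n) v x ≠ 0)
    (hH : ∀ x ∈ U, Hmc (2 * n) (heisF n) u x ≤ Hmc (2 * n) (heisF n) v x)
    (huv : ∀ x ∈ U, v x ≤ u x)
    (p₀ : Fin (2 * n) → ℝ) (hp₀ : p₀ ∈ U) (htouch : u p₀ = v p₀) :
    ∀ x ∈ U, u x = v x := by
  have hopen : IsOpen {x | x ∈ U ∧ u x = v x} := by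
    refine isOpen_iff_mem_nhds.2 fun x hx => ?_
    filter_upwards [hUopen.mem_nhds hx.1, eventually_eq_of_touching hn hUopen hu hv hns_u hns_v
      hH huv hx.1 hx.2] with y hy1 hy2 using ⟨hy1, hy2⟩
  have hsub := hUconn.isPreconnected.subset_of_closure_inter_subset hopen
    ⟨p₀, hp₀, hp₀, htouch⟩ (by
      rintro x ⟨hxcl, hxU⟩
      refine ⟨hxU, ?_⟩
      by_contra hne
      have hux := hu.continuousOn.continuousAt (hUopen.mem_nhds hxU)
      have hvx := hv.continuousOn.continuousAt (hUopen.mem_nhds hxU)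
      obtain ⟨y, hy, hy'⟩ := ((mem_closure_iff_frequently.1 hxcl).and_eventually
        (hux.ne_iff_eventually_ne hvx |>.1 hne)).exists
      exact hy' hy.2)
  exact fun x hx => (hsub hx).2
end
end

section
/- Let Ω ⊆ ℝ^m (m ≥ 2) be a bounded domain, F⃗ ∈ C¹(Ω) ∩ C⁰(Ω̄) a vector field, and v, u ∈ C²(Ω) ∩ C⁰(Ω̄). Suppose H_F(v) ≤ H_F(u) in Ω \ (S_F(u) ∪ S_F(v)) and v ≥ u on ∂Ω. Assume the (m−1)-dimensional Hausdorff measure of the closure of S_F(u) ∪ S_F(v) is zero, and that for some real constants a^{jk} (1 ≤ j,k ≤ m) with a^{jk} + a^{kj} = 0, the function div F⃗^b is strictly positive in Ω (or strictly negative in Ω), where F⃗^b := (Σ_k a^{1k}F_k, ..., Σ_k a^{mk}F_k). Then v ≥ u in Ω. -/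
open Set Finset MeasureTheory

noncomputable section

/-- The singular set `S_F(u) ∩ Ω = {x ∈ Ω | ∇u(x) + F(x) = 0}`. -/
def SingSet (N : ℕ) (Ω : Set (Fin N → ℝ)) (F : (Fin N → ℝ) → (Fin N → ℝ))
    (u : (Fin N → ℝ) → ℝ) : Set (Fin N → ℝ) :=
  {x ∈ Ω | gradF N F u x = 0}

/-- `F^b` for an antisymmetric constant coefficient matrix `A`, and its divergence. -/
def divFb (N : ℕ) (A : Matrix (Fin N) (Fin N) ℝ) (F : (Fin N → ℝ) → (Fin N → ℝ))
    (x : Fin N → ℝ) : ℝ :=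
  ∑ j : Fin N, pd N (j : ℕ) (fun y => ∑ k, A j k * F y k) x

/-- A nonempty compact set of vanishing `n`-dimensional Hausdorff measure, `n ≥ 1`, is covered by
finitely many small balls centred on it whose radii have small `n`-th power sum. -/
theorem IsCompact.exists_finset_ball_cover_of_hausdorffMeasure_zero {X : Type*} [MetricSpace X]
    [MeasurableSpace X] [BorelSpace X] {K : Set X} (hK : IsCompact K) (hne : K.Nonempty)
    {n : ℕ} (hn : n ≠ 0)
    (h0 : μH[(n : ℝ)] K = 0) {δ ρ : ℝ} (hδ : 0 < δ) (hρ : 0 < ρ) :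
    ∃ (s : Finset ℕ) (c : ℕ → X) (r : ℕ → ℝ), (∀ i, c i ∈ K) ∧ (∀ i, 0 < r i ∧ r i < ρ) ∧
      (K ⊆ ⋃ i ∈ s, Metric.ball (c i) (r i)) ∧ ∑ i ∈ s, r i ^ n ≤ δ := by
  obtain ⟨x₀, hx₀⟩ := hne
  rw [Measure.hausdorffMeasure_apply] at h0
  have h1 := (ENNReal.iSup_eq_zero.1 (ENNReal.iSup_eq_zero.1 h0 (ENNReal.ofReal (ρ / 2))))
    (by simpa using hρ)
  have h2 : (0 : ENNReal) < ENNReal.ofReal (δ / 2) := by simpa using hδ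
  rw [← h1] at h2
  simp only [iInf_lt_iff] at h2
  obtain ⟨t, htK, htd, hts⟩ := h2
  set d : ℕ → ℝ := fun i => (Metric.ediam (t i)).toReal with hd
  have hfin : ∀ i, Metric.ediam (t i) ≠ ⊤ := fun i => ne_top_of_le_ne_top (by simp) (htd i)
  have hd0 : ∀ i, 0 ≤ d i := fun i => ENNReal.toReal_nonneg
  have hdρ : ∀ i, d i < ρ := fun i =>
    (ENNReal.toReal_le_of_le_ofReal (by positivity) (htd i)).trans_lt (by linarith)
  have hsum : ∀ s : Finset ℕ, ∑ i ∈ s, d i ^ n ≤ δ / 2 := by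
    intro s
    have h3 : ∑ i ∈ s, Metric.ediam (t i) ^ n ≤ ENNReal.ofReal (δ / 2) := by
      refine le_trans ?_ hts.le
      refine le_trans ?_ (ENNReal.sum_le_tsum s)
      refine Finset.sum_le_sum fun i _ => ?_
      rcases (t i).eq_empty_or_nonempty with h | h
      · simp [h, hn]
      · simp [h]
    have h4 := ENNReal.toReal_le_of_le_ofReal (by positivity) h3
    rw [ENNReal.toReal_sum (fun i _ => ENNReal.pow_ne_top (hfin i))] at h4
    simpa [hd] using h4
  have hr : ∀ i, ∃ r, d i < r ∧ r < ρ ∧ r ^ n < d i ^ n + δ / 2 / 2 / 2 ^ i := by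
    intro i
    have hc : ContinuousAt (fun x : ℝ => x ^ n) (d i) := by fun_prop
    have h5 : ∀ᶠ x in nhds (d i), x ^ n < d i ^ n + δ / 2 / 2 / 2 ^ i :=
      hc.eventually_lt continuousAt_const (by simp; positivity)
    have h6 : ∀ᶠ x in nhds (d i), x < ρ := eventually_lt_nhds (hdρ i)
    obtain ⟨r, hr1, hr2⟩ := (((h5.and h6).filter_mono nhdsWithin_le_nhds).and
      (self_mem_nhdsWithin : Set.Ioi (d i) ∈ nhdsWithin (d i) (Set.Ioi (d i)))).exists
    exact ⟨r, hr2, hr1.2, hr1.1⟩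
  choose r hr1 hr2 hr3 using hr
  have hc : ∀ i, ∃ c ∈ K, (t i ∩ K).Nonempty → c ∈ t i := by
    intro i
    by_cases h : (t i ∩ K).Nonempty
    · exact ⟨h.some, h.some_mem.2, fun _ => h.some_mem.1⟩
    · exact ⟨x₀, hx₀, fun h' => absurd h' h⟩
  choose c hcK hct using hc
  have hcov : K ⊆ ⋃ i, Metric.ball (c i) (r i) := by
    intro x hx
    obtain ⟨i, hi⟩ := Set.mem_iUnion.1 (htK hx)
    refine Set.mem_iUnion.2 ⟨i, ?_⟩
    have h7 := Metric.edist_le_ediam_of_mem hi (hct i ⟨x, hi, hx⟩)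
    rw [Metric.mem_ball, dist_edist]
    exact (ENNReal.toReal_mono (hfin i) h7).trans_lt (hr1 i)
  obtain ⟨s, hs⟩ := hK.elim_finite_subcover _ (fun i => Metric.isOpen_ball) hcov
  refine ⟨s, c, r, hcK, fun i => ⟨(hd0 i).trans_lt (hr1 i), hr2 i⟩, hs, ?_⟩
  calc ∑ i ∈ s, r i ^ n ≤ ∑ i ∈ s, (d i ^ n + δ / 2 / 2 / 2 ^ i) :=
        Finset.sum_le_sum fun i _ => (hr3 i).le
    _ = ∑ i ∈ s, d i ^ n + ∑ i ∈ s, δ / 2 / 2 / 2 ^ i := Finset.sum_add_distrib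
    _ ≤ δ / 2 + δ / 2 := by
        refine add_le_add (hsum s) ?_
        exact ((summable_geometric_two' (δ / 2)).sum_le_tsum s
          fun i _ => by positivity).trans_eq (tsum_geometric_two' (δ / 2))
    _ = δ := by ring

/-- Smooth functions vanishing on a ball and equal to `1` off the ball of twice the radius, whose
gradients have `L¹` norm controlled by the `(m-1)`-st power of the radius. -/
theorem exists_ball_cutoff (m : ℕ) (hm : 1 ≤ m) : ∃ C : ℝ, 0 ≤ C ∧ ∀ (c : Fin m → ℝ) (r : ℝ),
    0 < r → ∃ η : (Fin m → ℝ) → ℝ, ContDiff ℝ 1 η ∧ (∀ x, 0 ≤ η x ∧ η x ≤ 1) ∧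
      (∀ x ∈ Metric.ball c r, η x = 0) ∧ (∀ x ∉ Metric.ball c (2 * r), η x = 1) ∧
      Integrable (fun x => ‖fderiv ℝ η x‖) ∧ ∫ x, ‖fderiv ℝ η x‖ ≤ C * r ^ (m - 1) := by
  let f : ContDiffBump (0 : Fin m → ℝ) := ⟨1, 2, by norm_num, by norm_num⟩
  have hf : ContDiff ℝ 1 f := f.contDiff
  have hint : Integrable (fun x => ‖fderiv ℝ f x‖) :=
    ((hf.continuous_fderiv one_ne_zero).norm).integrable_of_hasCompactSupport
      ((f.hasCompactSupport.fderiv ℝ).norm)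
  refine ⟨∫ x, ‖fderiv ℝ f x‖, integral_nonneg fun _ => norm_nonneg _, fun c r hr => ?_⟩
  have hfd : ∀ x, fderiv ℝ (fun x => 1 - f (r⁻¹ • (x - c))) x =
      -(r⁻¹ • fderiv ℝ f (r⁻¹ • (x - c))) := by
    intro x
    have h1 : HasFDerivAt (fun x : Fin m → ℝ => r⁻¹ • (x - c))
      (r⁻¹ • ContinuousLinearMap.id ℝ (Fin m → ℝ)) x :=
      ((hasFDerivAt_id x).sub_const c).const_smul r⁻¹
    have h2 := ((hf.differentiable one_ne_zero _).hasFDerivAt (x := r⁻¹ • (x - c))).comp x h1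
    have h3 := (h2.const_sub 1).fderiv
    simpa [Function.comp_def] using h3
  have hn : ∀ x, ‖fderiv ℝ (fun x => 1 - f (r⁻¹ • (x - c))) x‖ =
      r⁻¹ * ‖fderiv ℝ f (r⁻¹ • (x - c))‖ := by
    intro x
    rw [hfd, norm_neg, norm_smul, Real.norm_of_nonneg (by positivity)]
  refine ⟨fun x => 1 - f (r⁻¹ • (x - c)), ?_, fun x => ⟨by linarith [f.le_one (x := r⁻¹ • (x - c))],
    by linarith [f.nonneg (x := r⁻¹ • (x - c))]⟩, fun x hx => ?_, fun x hx => ?_, ?_, ?_⟩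
  · exact contDiff_const.sub (hf.comp (by fun_prop))
  · have : r⁻¹ • (x - c) ∈ Metric.closedBall (0 : Fin m → ℝ) 1 := by
      rw [mem_closedBall_zero_iff, norm_smul, Real.norm_of_nonneg (by positivity),
        inv_mul_le_iff₀ hr, mul_one, ← dist_eq_norm]
      exact (Metric.mem_ball.1 hx).le
    simp [f.one_of_mem_closedBall this]
  · have : r⁻¹ • (x - c) ∉ Metric.ball (0 : Fin m → ℝ) 2 := by
      rw [mem_ball_zero_iff, norm_smul, Real.norm_of_nonneg (by positivity),
        inv_mul_lt_iff₀ hr, ← dist_eq_norm, mul_comm]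
      exact hx
    rw [← f.support_eq, Function.notMem_support] at this
    simp [this]
  · simp only [hn]
    exact ((hint.comp_smul (inv_ne_zero hr.ne')).comp_sub_right c).const_mul _
  · simp only [hn]
    rw [integral_const_mul, integral_sub_right_eq_self (fun x => ‖fderiv ℝ f (r⁻¹ • x)‖) c,
      Measure.integral_comp_inv_smul_of_nonneg _ (fun x => ‖fderiv ℝ f x‖) hr.le]
    obtain ⟨k, rfl⟩ : ∃ k, m = k + 1 := ⟨m - 1, by omega⟩
    simp only [Module.finrank_fin_fun, smul_eq_mul, Nat.add_sub_cancel]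
    refine le_of_eq ?_
    field_simp
    ring

/-- Capacity-type cutoff functions: a compact set of vanishing `(m-1)`-dimensional Hausdorff measure
can be excised by cutoff functions with arbitrarily small gradient in `L¹`. -/
theorem IsCompact.exists_cutoff_of_hausdorffMeasure_zero {m : ℕ} (hm : 2 ≤ m)
    {K : Set (Fin m → ℝ)} (hK : IsCompact K) (h0 : μH[(m : ℝ) - 1] K = 0)
    {δ ρ : ℝ} (hδ : 0 < δ) (hρ : 0 < ρ) :
    ∃ η : (Fin m → ℝ) → ℝ, ContDiff ℝ 1 η ∧ (∀ x, 0 ≤ η x ∧ η x ≤ 1) ∧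
      (∃ U, IsOpen U ∧ K ⊆ U ∧ ∀ x ∈ U, η x = 0) ∧ (∀ x ∉ Metric.thickening ρ K, η x = 1) ∧
      Integrable (fun x => ‖fderiv ℝ η x‖) ∧ ∫ x, ‖fderiv ℝ η x‖ ≤ δ := by
  rcases K.eq_empty_or_nonempty with rfl | hne
  · exact ⟨fun _ => 1, contDiff_const, by simp, ⟨∅, by simp⟩, by simp, by simp, by simpa using hδ.le⟩
  obtain ⟨C, hC, hcut⟩ := exists_ball_cutoff m (by omega)
  have hm1 : ((m - 1 : ℕ) : ℝ) = (m : ℝ) - 1 := by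
    push_cast [Nat.cast_sub (show 1 ≤ m by omega)]
    ring
  rw [← hm1] at h0
  obtain ⟨s, c, r, hcK, hr, hcov, hsum⟩ :=
    hK.exists_finset_ball_cover_of_hausdorffMeasure_zero hne (n := m - 1) (by omega) h0
      (δ := δ / (C + 1)) (ρ := ρ / 2) (by positivity) (by positivity)
  have key : ∀ s : Finset ℕ, ∃ η : (Fin m → ℝ) → ℝ, ContDiff ℝ 1 η ∧ (∀ x, 0 ≤ η x ∧ η x ≤ 1) ∧
      (∀ x ∈ ⋃ i ∈ s, Metric.ball (c i) (r i), η x = 0) ∧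
      (∀ x ∉ ⋃ i ∈ s, Metric.ball (c i) (2 * r i), η x = 1) ∧
      Integrable (fun x => ‖fderiv ℝ η x‖) ∧
      ∫ x, ‖fderiv ℝ η x‖ ≤ C * ∑ i ∈ s, r i ^ (m - 1) := by
    intro s
    induction s using Finset.induction_on with
    | empty => exact ⟨fun _ => 1, contDiff_const, by simp, by simp, by simp, by simp, by simp⟩
    | insert i s hi ih =>
      obtain ⟨η, h1, h2, h3, h4, h5, h6⟩ := ih
      obtain ⟨ζ, g1, g2, g3, g4, g5, g6⟩ := hcut (c i) (r i) (hr i).1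
      have hle : ∀ x, ‖fderiv ℝ (fun x => ζ x * η x) x‖ ≤ ‖fderiv ℝ ζ x‖ + ‖fderiv ℝ η x‖ := by
        intro x
        rw [fderiv_fun_mul (g1.differentiable one_ne_zero x) (h1.differentiable one_ne_zero x)]
        refine (norm_add_le _ _).trans ?_
        rw [norm_smul, norm_smul, Real.norm_of_nonneg (g2 x).1, Real.norm_of_nonneg (h2 x).1]
        nlinarith [norm_nonneg (fderiv ℝ ζ x), norm_nonneg (fderiv ℝ η x), g2 x, h2 x]
      have hcd : ContDiff ℝ 1 (fun x => ζ x * η x) := g1.mul h1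
      have hint : Integrable (fun x => ‖fderiv ℝ (fun x => ζ x * η x) x‖) :=
        (g5.add h5).mono' (hcd.continuous_fderiv one_ne_zero).norm.aestronglyMeasurable
          (Filter.Eventually.of_forall fun x => by simpa using hle x)
      refine ⟨fun x => ζ x * η x, hcd, fun x => ⟨mul_nonneg (g2 x).1 (h2 x).1,
        mul_le_one₀ (g2 x).2 (h2 x).1 (h2 x).2⟩, ?_, ?_, hint, ?_⟩
      · intro x hx
        rw [Finset.set_biUnion_insert] at hx
        rcases hx with hx | hx
        · simp [g3 x hx]
        · simp [h3 x hx]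
      · intro x hx
        rw [Finset.set_biUnion_insert, Set.mem_union, not_or] at hx
        simp [g4 x hx.1, h4 x hx.2]
      · rw [Finset.sum_insert hi, mul_add]
        calc _ ≤ ∫ x, (‖fderiv ℝ ζ x‖ + ‖fderiv ℝ η x‖) := integral_mono hint (g5.add h5) hle
          _ = _ := integral_add g5 h5
          _ ≤ _ := add_le_add g6 h6
  obtain ⟨η, h1, h2, h3, h4, h5, h6⟩ := key s
  refine ⟨η, h1, h2, ⟨_, isOpen_biUnion fun i _ => Metric.isOpen_ball, hcov, h3⟩, ?_, h5, ?_⟩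
  · intro x hx
    refine h4 x fun hx' => hx ?_
    simp only [Set.mem_iUnion, exists_prop] at hx'
    obtain ⟨i, -, hi⟩ := hx'
    rw [Metric.mem_thickening_iff]
    exact ⟨c i, hcK i, (Metric.mem_ball.1 hi).trans (by linarith [(hr i).2])⟩
  · refine h6.trans ((mul_le_mul_of_nonneg_left hsum hC).trans ?_)
    rw [mul_div_assoc', div_le_iff₀ (by positivity)]
    nlinarith

theorem contDiff_of_contDiffAt_tsupport {E : Type*} [NormedAddCommGroup E] [NormedSpace ℝ E]
    {f : E → ℝ} {n : WithTop ℕ∞} (hf : ∀ x ∈ tsupport f, ContDiffAt ℝ n f x) :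
    ContDiff ℝ n f := by
  refine contDiff_iff_contDiffAt.2 fun x => ?_
  by_cases hx : x ∈ tsupport f
  · exact hf x hx
  · exact contDiffAt_const.congr_of_eventuallyEq (notMem_tsupport_iff_eventuallyEq.1 hx)

/-- The divergence theorem for a compactly supported field `W • X`, in expanded form. -/
theorem integral_div_mul_eq_zero {m : ℕ} {W : (Fin m → ℝ) → ℝ} (hW : ContDiff ℝ 1 W)
    (hc : HasCompactSupport W) {U : Set (Fin m → ℝ)} (hU : IsOpen U) (hWU : tsupport W ⊆ U)
    {X : Fin m → (Fin m → ℝ) → ℝ} (hX : ∀ i, ContDiffOn ℝ 1 (X i) U) :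
    let D := fun x => ∑ i : Fin m, (pd m i W x * X i x + W x * pd m i (X i) x)
    Continuous D ∧ HasCompactSupport D ∧ ∫ x, D x = 0 := by
  intro D
  have hts : ∀ i, tsupport (fun x => W x * X i x) ⊆ tsupport W := fun i =>
    closure_mono (Function.support_mul_subset_left W (X i))
  have hP : ∀ i, ContDiff ℝ 1 (fun x => W x * X i x) := fun i =>
    contDiff_of_contDiffAt_tsupport fun x hx => hW.contDiffAt.mul
      ((hX i).contDiffAt (hU.mem_nhds (hWU (hts i hx))))
  have hPc : ∀ i, HasCompactSupport (fun x => W x * X i x) := fun i => hc.mul_right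
  have hD : D = fun x => ∑ i : Fin m, fderiv ℝ (fun x => W x * X i x) x (ee m i) := by
    funext x
    refine Finset.sum_congr rfl fun i _ => ?_
    by_cases hx : x ∈ U
    · rw [fderiv_fun_mul (hW.differentiable one_ne_zero x)
        (((hX i).contDiffAt (hU.mem_nhds hx)).differentiableAt one_ne_zero)]
      simp [pd]
      ring
    · have h1 : x ∉ tsupport W := fun h => hx (hWU h)
      have h2 : x ∉ tsupport (fderiv ℝ W) := fun h => h1 (tsupport_fderiv_subset ℝ h)
      have h3 : x ∉ tsupport (fderiv ℝ (fun x => W x * X i x)) :=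
        fun h => h1 (hts i (tsupport_fderiv_subset ℝ h))
      simp [pd, image_eq_zero_of_notMem_tsupport h1, image_eq_zero_of_notMem_tsupport h2,
        image_eq_zero_of_notMem_tsupport h3]
  have hcont : ∀ i : Fin m, Continuous fun x => fderiv ℝ (fun x => W x * X i x) x (ee m i) :=
    fun i => ((hP i).continuous_fderiv one_ne_zero).clm_apply continuous_const
  have hsupp : ∀ i : Fin m,
      HasCompactSupport fun x => fderiv ℝ (fun x => W x * X i x) x (ee m i) :=
    fun i => (hPc i).fderiv_apply ℝ _
  refine ⟨?_, ?_, ?_⟩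
  · rw [hD]
    exact continuous_finsetSum _ fun i _ => hcont i
  · refine HasCompactSupport.intro (K := tsupport W) hc fun x hx => ?_
    have h2 : x ∉ tsupport (fderiv ℝ W) := fun h => hx (tsupport_fderiv_subset ℝ h)
    simp [D, pd, image_eq_zero_of_notMem_tsupport hx, image_eq_zero_of_notMem_tsupport h2]
  · rw [hD, integral_finsetSum _ fun i _ => (hcont i).integrable_of_hasCompactSupport (hsupp i)]
    refine Finset.sum_eq_zero fun i _ => ?_
    have h := integral_mul_fderiv_eq_neg_fderiv_mul_of_integrable (μ := volume)
      (f := fun _ : Fin m → ℝ => (1 : ℝ)) (g := fun x => W x * X i x) (v := ee m i)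
      (by simp) (by simpa using (hcont i).integrable_of_hasCompactSupport (hsupp i))
      (by simpa using (hP i).continuous.integrable_of_hasCompactSupport (hPc i))
      (by simp) (fun x _ => (hP i).differentiable one_ne_zero x)
    simpa using h

/-- A `C¹` cutoff function adapted to the superlevel sets of a function which is nonpositive on the
boundary of a bounded open set; its gradient is a nonnegative multiple of that of the function. -/
theorem exists_superlevel_cutoff {m : ℕ} {Ω : Set (Fin m → ℝ)} (hΩ : IsOpen Ω)
    (hb : Bornology.IsBounded Ω) {w : (Fin m → ℝ) → ℝ} (hw : ContDiffOn ℝ 1 w Ω)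
    (hwc : ContinuousOn w (closure Ω)) (hbd : ∀ x ∈ frontier Ω, w x ≤ 0) {ε : ℝ} (hε : 0 < ε) :
    ∃ W d : (Fin m → ℝ) → ℝ, ContDiff ℝ 1 W ∧ HasCompactSupport W ∧ tsupport W ⊆ Ω ∧
      (∀ x, 0 ≤ W x ∧ W x ≤ 1) ∧
      (∀ x ∈ Ω, (fderiv ℝ W x = d x • fderiv ℝ w x) ∧ 0 ≤ d x) ∧
      (∀ x ∈ Ω, ε < w x → 0 < W x) := by
  set W : (Fin m → ℝ) → ℝ := Ω.indicator fun x => expNegInvGlue (w x - ε) with hWdef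
  set K : Set (Fin m → ℝ) := closure Ω ∩ w ⁻¹' Set.Ici ε with hKdef
  have hKcl : IsClosed K := hwc.preimage_isClosed_of_isClosed isClosed_closure isClosed_Ici
  have hK : IsCompact K := hb.isCompact_closure.of_isClosed_subset hKcl Set.inter_subset_left
  have hKΩ : K ⊆ Ω := by
    rintro x ⟨hx, hxε⟩
    by_contra hxΩ
    have := hbd x (by rw [hΩ.frontier_eq]; exact ⟨hx, hxΩ⟩)
    exact absurd (hε.trans_le hxε) this.not_gt
  have hsupp : tsupport W ⊆ K := by
    refine closure_minimal (fun x hx => ?_) hKcl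
    have hxΩ : x ∈ Ω := Set.mem_of_indicator_ne_zero hx
    refine ⟨subset_closure hxΩ, ?_⟩
    rw [Function.mem_support, hWdef, Set.indicator_of_mem hxΩ] at hx
    by_contra h
    refine hx (expNegInvGlue.zero_of_nonpos ?_)
    have h' : w x < ε := not_le.1 h
    linarith
  have hev : ∀ x ∈ Ω, W =ᶠ[nhds x] fun x => expNegInvGlue (w x - ε) := fun x hx =>
    Filter.eventuallyEq_of_mem (hΩ.mem_nhds hx) fun y hy => Set.indicator_of_mem hy _
  have hle : ∀ t : ℝ, expNegInvGlue t ≤ 1 := by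
    intro t
    unfold expNegInvGlue
    split_ifs with h
    · exact zero_le_one
    · rw [Real.exp_le_one_iff, neg_nonpos]
      exact inv_nonneg.2 (not_le.1 h).le
  refine ⟨W, fun x => (w x - ε)⁻¹ ^ 2 * expNegInvGlue (w x - ε), ?_,
    HasCompactSupport.of_support_subset_isCompact hK (subset_closure.trans hsupp),
    hsupp.trans hKΩ, ?_, ?_, ?_⟩
  · refine contDiff_of_contDiffAt_tsupport fun x hx => ?_
    have hxΩ := hKΩ (hsupp hx)
    refine ContDiffAt.congr_of_eventuallyEq ?_ (hev x hxΩ)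
    exact (expNegInvGlue.contDiff (n := 1)).contDiffAt.comp x
      ((hw.contDiffAt (hΩ.mem_nhds hxΩ)).sub contDiffAt_const)
  · intro x
    by_cases hx : x ∈ Ω
    · rw [hWdef, Set.indicator_of_mem hx]
      exact ⟨expNegInvGlue.nonneg _, hle _⟩
    · rw [hWdef, Set.indicator_of_notMem hx]
      simp
  · intro x hx
    refine ⟨?_, mul_nonneg (by positivity) (expNegInvGlue.nonneg _)⟩
    rw [(hev x hx).fderiv_eq]
    have h1 := expNegInvGlue.hasDerivAt_polynomial_eval_inv_mul 1 (w x - ε)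
    simp only [Polynomial.eval_one, one_mul, Polynomial.derivative_one, sub_zero, mul_one,
      Polynomial.eval_pow, Polynomial.eval_X] at h1
    have h2 := ((hw.contDiffAt (hΩ.mem_nhds hx)).differentiableAt one_ne_zero).hasFDerivAt
    exact (h1.comp_hasFDerivAt x (h2.sub_const ε)).fderiv
  · intro x hx hxε
    rw [hWdef, Set.indicator_of_mem hx]
    exact expNegInvGlue.pos_of_pos (sub_pos.2 hxε)

theorem sum_sub_mul_normalized_sub {ι : Type*} [Fintype ι] {p q : ι → ℝ}
    (hp : p ≠ 0) (hq : q ≠ 0) :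
    ∑ i, (p i - q i) * (p i / √(∑ k, p k ^ 2) - q i / √(∑ k, q k ^ 2)) =
      (√(∑ k, p k ^ 2) + √(∑ k, q k ^ 2)) / 2 *
        ∑ i, (p i / √(∑ k, p k ^ 2) - q i / √(∑ k, q k ^ 2)) ^ 2 := by
  have pos : ∀ {p : ι → ℝ}, p ≠ 0 → 0 < ∑ k, p k ^ 2 := by
    intro p hp
    obtain ⟨i, hi⟩ := Function.ne_iff.1 hp
    exact Finset.sum_pos' (fun k _ => sq_nonneg _) ⟨i, Finset.mem_univ i, by
      have : p i ≠ 0 := hi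
      positivity⟩
  have hpa : √(∑ k, p k ^ 2) ^ 2 = ∑ k, p k ^ 2 := Real.sq_sqrt (pos hp).le
  have hqb : √(∑ k, q k ^ 2) ^ 2 = ∑ k, q k ^ 2 := Real.sq_sqrt (pos hq).le
  have ha := Real.sqrt_pos.2 (pos hp)
  have hb := Real.sqrt_pos.2 (pos hq)
  generalize √(∑ k, p k ^ 2) = a at *
  generalize √(∑ k, q k ^ 2) = b at *
  have h1 : ∑ i, (p i - q i) * (p i / a - q i / b) =
      (∑ k, p k ^ 2) / a - (∑ k, p k * q k) / b - (∑ k, p k * q k) / a + (∑ k, q k ^ 2) / b := by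
    simp only [Finset.sum_div, ← Finset.sum_sub_distrib, ← Finset.sum_add_distrib]
    exact Finset.sum_congr rfl fun i _ => by ring
  have h2 : ∑ i, (p i / a - q i / b) ^ 2 =
      (∑ k, p k ^ 2) / a ^ 2 - 2 * ((∑ k, p k * q k) / (a * b)) + (∑ k, q k ^ 2) / b ^ 2 := by
    simp only [Finset.sum_div, Finset.mul_sum, ← Finset.sum_sub_distrib, ← Finset.sum_add_distrib]
    exact Finset.sum_congr rfl fun i _ => by
      field_simp
      ring
  rw [h1, h2, ← hpa, ← hqb]
  field_simp
  ring

theorem sum_antisymm_mul_symm_eq_zero {ι : Type*} [Fintype ι] {A B : ι → ι → ℝ}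
    (hA : ∀ j k, A j k + A k j = 0) (hB : ∀ j k, B j k = B k j) :
    ∑ j, ∑ k, A j k * B j k = 0 := by
  have h1 : ∑ j, ∑ k, A j k * B j k = ∑ j, ∑ k, A k j * B j k := by
    rw [Finset.sum_comm]
    exact Finset.sum_congr rfl fun j _ => Finset.sum_congr rfl fun k _ => by rw [hB]
  have h2 : ∑ j, ∑ k, A j k * B j k + ∑ j, ∑ k, A k j * B j k = 0 := by
    simp only [← Finset.sum_add_distrib, ← add_mul, hA, zero_mul, Finset.sum_const_zero]
  linarith

theorem abs_pd_le_norm_fderiv (N k : ℕ) (f : (Fin N → ℝ) → ℝ) (x : Fin N → ℝ) :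
    |pd N k f x| ≤ ‖fderiv ℝ f x‖ := by
  have h : ‖ee N k‖ ≤ 1 := by
    refine (pi_norm_le_iff_of_nonneg zero_le_one).2 fun i => ?_
    unfold ee
    split_ifs <;> simp
  exact ((fderiv ℝ f x).le_opNorm _).trans (mul_le_of_le_one_right (norm_nonneg _) h)

theorem ContDiffOn.pd {N k : ℕ} {Ω : Set (Fin N → ℝ)} (hΩ : IsOpen Ω) {u : (Fin N → ℝ) → ℝ}
    (hu : ContDiffOn ℝ 2 u Ω) : ContDiffOn ℝ 1 (_root_.pd N k u) Ω :=
  (hu.fderiv_of_isOpen hΩ (m := 1) (by norm_num)).clm_apply contDiffOn_const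

theorem contDiffOn_gradF {N : ℕ} {Ω : Set (Fin N → ℝ)} (hΩ : IsOpen Ω)
    {F : (Fin N → ℝ) → (Fin N → ℝ)} (hF : ContDiffOn ℝ 1 F Ω) {u : (Fin N → ℝ) → ℝ}
    (hu : ContDiffOn ℝ 2 u Ω) : ContDiffOn ℝ 1 (gradF N F u) Ω :=
  contDiffOn_pi.2 fun i => (hu.pd hΩ).add (contDiffOn_pi.1 hF i)

theorem sum_sq_ne_zero {N : ℕ} {p : Fin N → ℝ} (hp : p ≠ 0) : ∑ k, p k ^ 2 ≠ 0 := by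
  intro h
  refine hp (funext fun i => ?_)
  have := (Finset.sum_eq_zero_iff_of_nonneg fun k _ => sq_nonneg (p k)).1 h i (Finset.mem_univ i)
  simpa using this

theorem contDiffOn_legN {N : ℕ} {Ω U : Set (Fin N → ℝ)} (hΩ : IsOpen Ω)
    {F : (Fin N → ℝ) → (Fin N → ℝ)} (hF : ContDiffOn ℝ 1 F Ω) {u : (Fin N → ℝ) → ℝ}
    (hu : ContDiffOn ℝ 2 u Ω) (hU : U ⊆ Ω) (h0 : ∀ x ∈ U, gradF N F u x ≠ 0) (i : Fin N) :
    ContDiffOn ℝ 1 (fun x => legN N F u x i) U := by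
  have h := contDiffOn_pi.1 ((contDiffOn_gradF hΩ hF hu).mono hU)
  have hs : ∀ x ∈ U, ∑ k, gradF N F u x k ^ 2 ≠ 0 := fun x hx => sum_sq_ne_zero (h0 x hx)
  exact (h i).div ((ContDiffOn.sum fun k _ => (h k).pow 2).sqrt hs)
    fun x hx => Real.sqrt_ne_zero'.2
      ((Finset.sum_nonneg fun k _ => sq_nonneg _).lt_of_ne (hs x hx).symm)

theorem abs_legN_le_one (N : ℕ) (F : (Fin N → ℝ) → (Fin N → ℝ)) (u : (Fin N → ℝ) → ℝ)
    (x : Fin N → ℝ) (i : Fin N) : |legN N F u x i| ≤ 1 := by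
  unfold legN
  rw [abs_div, abs_of_nonneg (Real.sqrt_nonneg _)]
  refine div_le_one_of_le₀ (Real.abs_le_sqrt ?_) (Real.sqrt_nonneg _)
  exact Finset.single_le_sum (f := fun k => gradF N F u x k ^ 2) (fun k _ => sq_nonneg _)
    (Finset.mem_univ i)

theorem SingSet.mem_of_mem_closure {N : ℕ} {Ω : Set (Fin N → ℝ)} (hΩ : IsOpen Ω)
    {F : (Fin N → ℝ) → (Fin N → ℝ)} (hF : ContDiffOn ℝ 1 F Ω) {u : (Fin N → ℝ) → ℝ}
    (hu : ContDiffOn ℝ 2 u Ω) {x : Fin N → ℝ} (hx : x ∈ Ω) (hxc : x ∈ closure (SingSet N Ω F u)) :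
    x ∈ SingSet N Ω F u := by
  refine ⟨hx, ?_⟩
  by_contra h
  have hc : ContinuousAt (gradF N F u) x :=
    (contDiffOn_gradF hΩ hF hu).continuousOn.continuousAt (hΩ.mem_nhds hx)
  obtain ⟨y, hy, hy'⟩ := ((mem_closure_iff_frequently.1 hxc).and_eventually
    (hc.eventually_ne h)).exists
  exact hy' hy.2

theorem pd_sub_eq_gradF_sub_gradF {N : ℕ} {F : (Fin N → ℝ) → (Fin N → ℝ)} {u v : (Fin N → ℝ) → ℝ}
    {x : Fin N → ℝ} (hu : DifferentiableAt ℝ u x) (hv : DifferentiableAt ℝ v x) (i : Fin N) :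
    pd N i (fun y => u y - v y) x = gradF N F u x i - gradF N F v x i := by
  simp only [pd, gradF, fderiv_fun_sub hu hv, sub_apply]
  ring

/-- The curvature comparison forces the horizontal normals to agree on the set where `v < u`, away
from the singular set. -/
theorem legN_eq_of_Hmc_le {m : ℕ} (hm : 2 ≤ m) {Ω : Set (Fin m → ℝ)} (hΩopen : IsOpen Ω)
    (hΩbdd : Bornology.IsBounded Ω) {F : (Fin m → ℝ) → (Fin m → ℝ)} (hF : ContDiffOn ℝ 1 F Ω)
    {v u W d : (Fin m → ℝ) → ℝ} (hv : ContDiffOn ℝ 2 v Ω) (hu : ContDiffOn ℝ 2 u Ω)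
    (hH : ∀ x ∈ Ω \ (SingSet m Ω F u ∪ SingSet m Ω F v), Hmc m F v x ≤ Hmc m F u x)
    (hHaus : μH[(m : ℝ) - 1] (closure (SingSet m Ω F u ∪ SingSet m Ω F v)) = 0)
    (hW : ContDiff ℝ 1 W) (hWc : HasCompactSupport W) (hWΩ : tsupport W ⊆ Ω)
    (hW01 : ∀ x, 0 ≤ W x ∧ W x ≤ 1)
    (hWd : ∀ x ∈ Ω, fderiv ℝ W x = d x • fderiv ℝ (fun y => u y - v y) x ∧ 0 ≤ d x)
    {x₀ : Fin m → ℝ} (hx₀ : x₀ ∈ Ω) (hd : 0 < d x₀) (hu₀ : gradF m F u x₀ ≠ 0)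
    (hv₀ : gradF m F v x₀ ≠ 0) : legN m F u x₀ = legN m F v x₀ := by
  set S := SingSet m Ω F u ∪ SingSet m Ω F v with hS
  have hSΩ : S ⊆ Ω := Set.union_subset (fun x hx => hx.1) (fun x hx => hx.1)
  have hSc : IsCompact (closure S) := (hΩbdd.subset hSΩ).isCompact_closure
  set U := Ω \ closure S with hU
  have hUo : IsOpen U := hΩopen.sdiff isClosed_closure
  have hUu : ∀ x ∈ U, gradF m F u x ≠ 0 := fun x hx h =>
    hx.2 (subset_closure (Or.inl ⟨hx.1, h⟩))
  have hUv : ∀ x ∈ U, gradF m F v x ≠ 0 := fun x hx h =>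
    hx.2 (subset_closure (Or.inr ⟨hx.1, h⟩))
  have hx₀U : x₀ ∈ U := by
    refine ⟨hx₀, fun h => ?_⟩
    rw [hS, closure_union] at h
    rcases h with h | h
    · exact hu₀ (SingSet.mem_of_mem_closure hΩopen hF hu hx₀ h).2
    · exact hv₀ (SingSet.mem_of_mem_closure hΩopen hF hv hx₀ h).2
  have hLu := contDiffOn_legN hΩopen hF hu Set.sdiff_subset hUu
  have hLv := contDiffOn_legN hΩopen hF hv Set.sdiff_subset hUv
  set X : Fin m → (Fin m → ℝ) → ℝ := fun i x => legN m F u x i - legN m F v x i with hXdef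
  have hX : ∀ i, ContDiffOn ℝ 1 (X i) U := fun i => (hLu i).sub (hLv i)
  have hXabs : ∀ i x, |X i x| ≤ 2 := fun i x =>
    (abs_sub _ _).trans (by linarith [abs_legN_le_one m F u x i, abs_legN_le_one m F v x i])
  have hdiffu : ∀ x ∈ Ω, DifferentiableAt ℝ u x := fun x hx =>
    (hu.contDiffAt (hΩopen.mem_nhds hx)).differentiableAt two_ne_zero
  have hdiffv : ∀ x ∈ Ω, DifferentiableAt ℝ v x := fun x hx =>
    (hv.contDiffAt (hΩopen.mem_nhds hx)).differentiableAt two_ne_zero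
  set G : (Fin m → ℝ) → ℝ := fun x => ∑ i : Fin m, pd m i W x * X i x with hG
  have hGc : ContinuousOn G U := continuousOn_finsetSum _ fun i _ =>
    (((hW.continuous_fderiv one_ne_zero).clm_apply continuous_const).continuousOn).mul
      (hX i).continuousOn
  have hGeq : ∀ x ∈ U, G x = d x * ((√(∑ k, gradF m F u x k ^ 2) + √(∑ k, gradF m F v x k ^ 2)) / 2
      * ∑ i, X i x ^ 2) := by
    intro x hx
    have h1 := sum_sub_mul_normalized_sub (hUu x hx) (hUv x hx)
    simp only [hXdef, legN]
    rw [← h1, Finset.mul_sum]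
    refine Finset.sum_congr rfl fun i _ => ?_
    rw [← pd_sub_eq_gradF_sub_gradF (hdiffu x hx.1) (hdiffv x hx.1) i]
    simp only [pd, (hWd x hx.1).1, smul_apply, smul_eq_mul, hXdef, legN]
    ring
  have hG0 : ∀ x ∈ U, 0 ≤ G x := by
    intro x hx
    rw [hGeq x hx]
    exact mul_nonneg (hWd x hx.1).2 (mul_nonneg (by positivity)
      (Finset.sum_nonneg fun i _ => sq_nonneg _))
  by_contra hne
  have hGpos : 0 < G x₀ := by
    rw [hGeq x₀ hx₀U]
    have hu' := Real.sqrt_pos.2 ((Finset.sum_nonneg fun k _ => sq_nonneg _).lt_of_ne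
      (sum_sq_ne_zero hu₀).symm)
    have hX' : 0 < ∑ i, X i x₀ ^ 2 := (Finset.sum_nonneg fun k _ => sq_nonneg _).lt_of_ne
      (sum_sq_ne_zero (p := fun i => X i x₀) fun h =>
        hne (funext fun i => sub_eq_zero.1 (congrFun h i))).symm
    positivity
  set c := G x₀ / 2 with hc
  have hcpos : 0 < c := by positivity
  obtain ⟨s, hs, hsB⟩ := Metric.mem_nhds_iff.1 (Filter.inter_mem (hUo.mem_nhds hx₀U)
    ((hGc.continuousAt (hUo.mem_nhds hx₀U)).eventually_const_lt (half_lt_self hGpos)))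
  set B := Metric.ball x₀ (s / 2) with hB
  have hBvol : 0 < volume.real B :=
    ENNReal.toReal_pos (Metric.measure_ball_pos volume x₀ (by positivity)).ne'
      Metric.isBounded_ball.measure_lt_top.ne
  have hm0 : (0 : ℝ) < m := by exact_mod_cast (by omega : 0 < m)
  obtain ⟨η, hη, hη01, ⟨O, hO, hSO, hηO⟩, hη1, hηint, hηδ⟩ :=
    hSc.exists_cutoff_of_hausdorffMeasure_zero hm hHaus
      (δ := c * volume.real B / (4 * m)) (ρ := s / 2) (by positivity) (by positivity)
  have hηB : ∀ x ∈ B, η x = 1 := by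
    intro x hx
    refine hη1 x fun h => ?_
    obtain ⟨z, hz, hxz⟩ := Metric.mem_thickening_iff.1 h
    have hz' : z ∈ Metric.ball x₀ s := by
      have := dist_triangle_left z x₀ x
      have hx' := Metric.mem_ball.1 hx
      rw [Metric.mem_ball]
      linarith
    exact (hsB hz').1.2 hz
  have hηW : tsupport (fun x => η x * W x) ⊆ U := by
    intro x hx
    refine ⟨hWΩ (closure_mono (Function.support_mul_subset_right η W) hx), fun hxS => ?_⟩
    refine notMem_tsupport_iff_eventuallyEq.2 ?_ hx
    filter_upwards [hO.mem_nhds (hSO hxS)] with y hy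
    simp [hηO y hy]
  obtain ⟨hDc, hDs, hD0⟩ := integral_div_mul_eq_zero (hη.mul hW) (hWc.mul_left) hUo hηW hX
  have hlow : ∀ x, B.indicator (fun _ => c) x - 2 * m * ‖fderiv ℝ η x‖ ≤
      ∑ i : Fin m, (pd m i (fun x => η x * W x) x * X i x + η x * W x * pd m i (X i) x) := by
    intro x
    by_cases hx : x ∈ U
    · have hprod : ∀ i : Fin m, pd m i (fun x => η x * W x) x =
          η x * pd m i W x + W x * pd m i η x := by
        intro i
        simp only [pd]
        rw [fderiv_fun_mul (hη.differentiable one_ne_zero x) (hW.differentiable one_ne_zero x)]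
        simp
      have hdX : ∑ i : Fin m, pd m i (X i) x = Hmc m F u x - Hmc m F v x := by
        simp only [Hmc, ← Finset.sum_sub_distrib]
        refine Finset.sum_congr rfl fun i _ => ?_
        simp only [pd, hXdef]
        rw [fderiv_fun_sub (((hLu i).contDiffAt (hUo.mem_nhds hx)).differentiableAt one_ne_zero)
          (((hLv i).contDiffAt (hUo.mem_nhds hx)).differentiableAt one_ne_zero)]
        rfl
      have hdX0 : 0 ≤ ∑ i : Fin m, pd m i (X i) x := by
        rw [hdX]
        exact sub_nonneg.2 (hH x ⟨hx.1, fun h => hx.2 (subset_closure h)⟩)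
      have hηX : -(2 * m * ‖fderiv ℝ η x‖) ≤ W x * ∑ i : Fin m, pd m i η x * X i x := by
        refine neg_le_of_abs_le ?_
        rw [abs_mul, abs_of_nonneg (hW01 x).1]
        refine (mul_le_of_le_one_left (abs_nonneg _) (hW01 x).2).trans ?_
        refine (Finset.abs_sum_le_sum_abs _ _).trans ?_
        calc ∑ i : Fin m, |pd m i η x * X i x| ≤ ∑ _i : Fin m, ‖fderiv ℝ η x‖ * 2 :=
              Finset.sum_le_sum fun i _ => by
                rw [abs_mul]
                exact mul_le_mul (abs_pd_le_norm_fderiv m i η x) (hXabs i x) (abs_nonneg _)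
                  (norm_nonneg _)
          _ = 2 * m * ‖fderiv ℝ η x‖ := by
              simp
              ring
      have hGB : B.indicator (fun _ => c) x ≤ η x * G x := by
        by_cases hxB : x ∈ B
        · rw [Set.indicator_of_mem hxB, hηB x hxB, one_mul]
          exact (hsB (Metric.ball_subset_ball (by linarith) hxB)).2.le
        · rw [Set.indicator_of_notMem hxB]
          exact mul_nonneg (hη01 x).1 (hG0 x hx)
      have hexp : ∑ i : Fin m, (pd m i (fun x => η x * W x) x * X i x +
          η x * W x * pd m i (X i) x) = η x * G x + W x * (∑ i : Fin m, pd m i η x * X i x) +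
            η x * W x * ∑ i : Fin m, pd m i (X i) x := by
        simp only [hG, hprod, Finset.mul_sum, ← Finset.sum_add_distrib]
        exact Finset.sum_congr rfl fun i _ => by ring
      rw [hexp]
      have := mul_nonneg (mul_nonneg (hη01 x).1 (hW01 x).1) hdX0
      linarith
    · have hxB : x ∉ B := fun h => hx (hsB (Metric.ball_subset_ball (by linarith) h)).1
      have h1 : x ∉ tsupport (fun x => η x * W x) := fun h => hx (hηW h)
      have h2 : x ∉ tsupport (fderiv ℝ (fun x => η x * W x)) :=
        fun h => h1 (tsupport_fderiv_subset ℝ h)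
      have h3 : η x * W x = 0 := image_eq_zero_of_notMem_tsupport (f := fun x => η x * W x) h1
      have h4 : fderiv ℝ (fun x => η x * W x) x = 0 := image_eq_zero_of_notMem_tsupport h2
      rw [Set.indicator_of_notMem hxB]
      simp only [h3, pd, h4]
      simp
      positivity
  have hBint : Integrable (B.indicator fun _ => c) :=
    (integrable_indicator_iff measurableSet_ball).2
      (integrableOn_const Metric.isBounded_ball.measure_lt_top.ne)
  have hfin := integral_mono (hBint.sub (hηint.const_mul (2 * m)))
    (hDc.integrable_of_hasCompactSupport hDs) hlow
  rw [hD0] at hfin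
  simp only [Pi.sub_apply] at hfin
  rw [integral_sub hBint (hηint.const_mul _), integral_indicator_const _ measurableSet_ball,
    integral_const_mul, smul_eq_mul] at hfin
  have h5 : 2 * m * ∫ x, ‖fderiv ℝ η x‖ ≤ 2 * m * (c * volume.real B / (4 * m)) :=
    mul_le_mul_of_nonneg_left hηδ (by positivity)
  have h6 : 2 * m * (c * volume.real B / (4 * m)) = c * volume.real B / 2 := by
    field_simp
    ring
  nlinarith [mul_pos hcpos hBvol]

/-- The divergence of `A (∇u + F)` for an antisymmetric matrix `A` does not involve `u`. -/
theorem div_antisymm_mul_gradF {m : ℕ} {Ω : Set (Fin m → ℝ)} (hΩ : IsOpen Ω)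
    {F : (Fin m → ℝ) → (Fin m → ℝ)} (hF : ContDiffOn ℝ 1 F Ω) {u : (Fin m → ℝ) → ℝ}
    (hu : ContDiffOn ℝ 2 u Ω) {A : Matrix (Fin m) (Fin m) ℝ} (hA : ∀ j k, A j k + A k j = 0)
    {x : Fin m → ℝ} (hx : x ∈ Ω) :
    ∑ j : Fin m, pd m j (fun y => ∑ k, A j k * gradF m F u y k) x = divFb m A F x := by
  have hFd : ∀ k, DifferentiableAt ℝ (fun y => F y k) x := fun k =>
    ((contDiffOn_pi.1 hF k).contDiffAt (hΩ.mem_nhds hx)).differentiableAt one_ne_zero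
  have hud : ∀ k : ℕ, DifferentiableAt ℝ (pd m k u) x := fun k =>
    ((hu.pd hΩ).contDiffAt (hΩ.mem_nhds hx)).differentiableAt one_ne_zero
  have hu2 : ContDiffAt ℝ 2 u x := hu.contDiffAt (hΩ.mem_nhds hx)
  have hfd : DifferentiableAt ℝ (fderiv ℝ u) x :=
    (hu2.fderiv_right (m := 1) (by norm_num)).differentiableAt one_ne_zero
  have hpp : ∀ j k : Fin m, pd m j (pd m k u) x = fderiv ℝ (fderiv ℝ u) x (ee m j) (ee m k) := by
    intro j k
    have : pd m k u = fun y => fderiv ℝ u y (ee m k) := rfl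
    rw [pd, this, fderiv_clm_apply hfd (differentiableAt_const _)]
    simp
  have hsym : ∀ j k : Fin m, pd m j (pd m k u) x = pd m k (pd m j u) x := by
    intro j k
    rw [hpp, hpp]
    exact (hu2.isSymmSndFDerivAt (by simp)).eq _ _
  have h0 := sum_antisymm_mul_symm_eq_zero hA hsym
  rw [← zero_add (divFb m A F x), ← h0]
  simp only [divFb, ← Finset.sum_add_distrib]
  refine Finset.sum_congr rfl fun j _ => ?_
  have h1 : (fun y => ∑ k, A j k * gradF m F u y k) =
      fun y => ∑ k : Fin m, A j k * pd m k u y + ∑ k, A j k * F y k := by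
    funext y
    simp only [gradF, mul_add, Finset.sum_add_distrib]
  have h2 : ∀ k : Fin m, DifferentiableAt ℝ (fun y => A j k * pd m k u y) x := fun k =>
    (hud k).const_mul _
  have h3 : pd m j (fun y => ∑ k : Fin m, A j k * pd m k u y) x =
      ∑ k : Fin m, A j k * pd m j (pd m k u) x := by
    rw [pd, fderiv_fun_sum fun k _ => h2 k, _root_.sum_apply]
    refine Finset.sum_congr rfl fun k _ => ?_
    rw [fderiv_const_mul (hud k)]
    rfl
  rw [h1, ← h3, pd, fderiv_fun_add (DifferentiableAt.fun_sum fun k _ => h2 k)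
    (DifferentiableAt.fun_sum fun k _ => (hFd k).const_mul _)]
  rfl

theorem sum_antisymm_mul_eq_zero_of_normalized_eq {N : ℕ} {A : Matrix (Fin N) (Fin N) ℝ}
    (hA : ∀ j k, A j k + A k j = 0) {p q : Fin N → ℝ}
    (h : p ≠ 0 → q ≠ 0 → ∀ i, p i / √(∑ k, p k ^ 2) = q i / √(∑ k, q k ^ 2)) :
    ∑ j, (p j - q j) * ∑ k, A j k * p k = 0 := by
  have hpp : ∑ j, p j * ∑ k, A j k * p k = 0 := by
    rw [← sum_antisymm_mul_symm_eq_zero hA (B := fun j k => p j * p k) fun j k => mul_comm _ _]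
    simp only [Finset.mul_sum]
    exact Finset.sum_congr rfl fun j _ => Finset.sum_congr rfl fun k _ => by ring
  by_cases hp : p = 0
  · simp [hp]
  have hq : ∃ t : ℝ, ∀ i, q i = t * p i := by
    by_cases hq : q = 0
    · exact ⟨0, by simp [hq]⟩
    refine ⟨√(∑ k, q k ^ 2) / √(∑ k, p k ^ 2), fun i => ?_⟩
    have hb := Real.sqrt_pos.2 ((Finset.sum_nonneg fun k _ => sq_nonneg _).lt_of_ne
      (sum_sq_ne_zero hq).symm)
    have := h hp hq i
    rw [div_mul_eq_mul_div, mul_div_assoc, this]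
    field_simp
  obtain ⟨t, ht⟩ := hq
  calc _ = (1 - t) * ∑ j, p j * ∑ k, A j k * p k := by
        rw [Finset.mul_sum]
        exact Finset.sum_congr rfl fun j _ => by
          rw [ht j]
          ring
    _ = 0 := by rw [hpp, mul_zero]

theorem divFb_neg (N : ℕ) (A : Matrix (Fin N) (Fin N) ℝ) (F : (Fin N → ℝ) → (Fin N → ℝ))
    (x : Fin N → ℝ) : divFb N (-A) F x = -divFb N A F x := by
  simp only [divFb, pd, Matrix.neg_apply, neg_mul, Finset.sum_neg_distrib, fderiv_fun_neg,
    neg_apply]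

theorem le_of_Hmc_le_of_divFb_pos {m : ℕ} (hm : 2 ≤ m)
    {Ω : Set (Fin m → ℝ)} (hΩopen : IsOpen Ω) (hΩbdd : Bornology.IsBounded Ω)
    {F : (Fin m → ℝ) → (Fin m → ℝ)} (hF : ContDiffOn ℝ 1 F Ω)
    {v u : (Fin m → ℝ) → ℝ} (hv : ContDiffOn ℝ 2 v Ω) (hu : ContDiffOn ℝ 2 u Ω)
    (hvcont : ContinuousOn v (closure Ω)) (hucont : ContinuousOn u (closure Ω))
    (hH : ∀ x ∈ Ω \ (SingSet m Ω F u ∪ SingSet m Ω F v), Hmc m F v x ≤ Hmc m F u x)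
    (hbd : ∀ x ∈ frontier Ω, u x ≤ v x)
    (hHaus : μH[(m : ℝ) - 1] (closure (SingSet m Ω F u ∪ SingSet m Ω F v)) = 0)
    {A : Matrix (Fin m) (Fin m) ℝ} (hA : ∀ j k, A j k + A k j = 0)
    (hdiv : ∀ x ∈ Ω, 0 < divFb m A F x) :
    ∀ x ∈ Ω, u x ≤ v x := by
  intro x₀ hx₀
  by_contra! hlt
  obtain ⟨W, d, hW, hWc, hWΩ, hW01, hWd, hWpos⟩ := exists_superlevel_cutoff hΩopen hΩbdd
    (w := fun y => u y - v y) ((hu.sub hv).of_le one_le_two) (hucont.sub hvcont)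
    (fun x hx => sub_nonpos.2 (hbd x hx)) (ε := (u x₀ - v x₀) / 2) (by linarith)
  have hX : ∀ j : Fin m, ContDiffOn ℝ 1 (fun y => ∑ k, A j k * gradF m F u y k) Ω := fun j =>
    ContDiffOn.sum fun k _ =>
      contDiffOn_const.mul (contDiffOn_pi.1 (contDiffOn_gradF hΩopen hF hu) k)
  obtain ⟨hDc, hDs, hD0⟩ := integral_div_mul_eq_zero hW hWc hΩopen hWΩ hX
  have hD : ∀ x ∈ Ω, ∑ j : Fin m, (pd m j W x * (∑ k, A j k * gradF m F u x k) +
      W x * pd m j (fun y => ∑ k, A j k * gradF m F u y k) x) = W x * divFb m A F x := by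
    intro x hx
    rw [Finset.sum_add_distrib, ← Finset.mul_sum, div_antisymm_mul_gradF hΩopen hF hu hA hx,
      add_eq_right]
    have h1 : ∑ j : Fin m, pd m j W x * (∑ k, A j k * gradF m F u x k) =
        d x * ∑ j : Fin m, (gradF m F u x j - gradF m F v x j) *
          ∑ k, A j k * gradF m F u x k := by
      rw [Finset.mul_sum]
      refine Finset.sum_congr rfl fun j _ => ?_
      rw [← pd_sub_eq_gradF_sub_gradF
        ((hu.contDiffAt (hΩopen.mem_nhds hx)).differentiableAt two_ne_zero)
        ((hv.contDiffAt (hΩopen.mem_nhds hx)).differentiableAt two_ne_zero)]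
      simp only [pd, (hWd x hx).1, smul_apply, smul_eq_mul]
      ring
    rw [h1]
    rcases (hWd x hx).2.eq_or_lt with h | h
    · rw [← h, zero_mul]
    · rw [sum_antisymm_mul_eq_zero_of_normalized_eq hA fun hp hq i => congrFun
        (legN_eq_of_Hmc_le hm hΩopen hΩbdd hF hv hu hH hHaus hW hWc hWΩ hW01 hWd hx h hp hq) i,
        mul_zero]
  refine (Continuous.integral_pos_of_hasCompactSupport_nonneg_nonzero (μ := volume) (x := x₀)
    hDc hDs ?_ ?_).ne' hD0
  · intro x
    by_cases hx : x ∈ Ω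
    · beta_reduce
      rw [hD x hx]
      exact mul_nonneg (hW01 x).1 (hdiv x hx).le
    · have h1 : x ∉ tsupport W := fun h => hx (hWΩ h)
      have h2 : x ∉ tsupport (fderiv ℝ W) := fun h => h1 (tsupport_fderiv_subset ℝ h)
      simp [pd, image_eq_zero_of_notMem_tsupport h1, image_eq_zero_of_notMem_tsupport h2]
  · rw [hD x₀ hx₀]
    exact ne_of_gt (mul_pos (hWpos x₀ hx₀ (by linarith)) (hdiv x₀ hx₀))

/-- Theorem C″: maximum principle (comparison principle) for
`H_F` in the presence of a singular set of vanishing `(m−1)`-dimensional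
Hausdorff measure. -/
theorem comparison_principle_with_singular_set
    (m : ℕ) (hm : 2 ≤ m)
    (Ω : Set (Fin m → ℝ)) (hΩopen : IsOpen Ω) (hΩconn : IsConnected Ω)
    (hΩbdd : Bornology.IsBounded Ω)
    (F : (Fin m → ℝ) → (Fin m → ℝ))
    (hF : ContDiffOn ℝ 1 F Ω) (hFcont : ContinuousOn F (closure Ω))
    (v u : (Fin m → ℝ) → ℝ)
    (hv : ContDiffOn ℝ 2 v Ω) (hu : ContDiffOn ℝ 2 u Ω)
    (hvcont : ContinuousOn v (closure Ω)) (hucont : ContinuousOn u (closure Ω))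
    (hH : ∀ x ∈ Ω \ (SingSet m Ω F u ∪ SingSet m Ω F v), Hmc m F v x ≤ Hmc m F u x)
    (hbd : ∀ x ∈ frontier Ω, u x ≤ v x)
    (hHaus : μH[(m : ℝ) - 1] (closure (SingSet m Ω F u ∪ SingSet m Ω F v)) = 0)
    (A : Matrix (Fin m) (Fin m) ℝ) (hA : ∀ j k, A j k + A k j = 0)
    (hdiv : (∀ x ∈ Ω, 0 < divFb m A F x) ∨ (∀ x ∈ Ω, divFb m A F x < 0)) :
    ∀ x ∈ Ω, u x ≤ v x := by
  rcases hdiv with h | h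
  · exact le_of_Hmc_le_of_divFb_pos hm hΩopen hΩbdd hF hv hu hvcont hucont hH hbd hHaus hA h
  · refine le_of_Hmc_le_of_divFb_pos hm hΩopen hΩbdd hF hv hu hvcont hucont hH hbd hHaus (A := -A)
      (fun j k => ?_) fun x hx => ?_
    · simp only [Matrix.neg_apply]
      linarith [hA j k]
    · rw [divFb_neg]
      exact neg_pos.2 (h x hx)
end
end
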